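/- arXiv:1405.3532 — 2 statements merged into one kernel-verified Lean document; each statement's English description precedes it below -/
import Mathlib

section
/- Let ℓ ≥ 2 and let r satisfy 0 ≤ r < 2^ℓ − 1. Then P¹_x(2^ℓ + r) = P¹_x(r) + 3 if r ≤ 2^{ℓ−1}, and P¹_x(2^ℓ + r) = P¹_x(2^{ℓ+1} − r) if r > 2^{ℓ−1}. In particular, the sequence (P¹_x(n))_{n≥0} is 2-regular. -/
/-- The 2-kernel of a sequence `s : ℕ → ℤ`. -/
def kernel2 (s : ℕ → ℤ) : Set (ℕ → ℤ) :=
  {t | ∃ i j : ℕ, j < 2 ^ i ∧ t = fun n => s (2 ^ i * n + j)}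

/-- A sequence is 2-regular if the ℤ-module spanned by its 2-kernel is finitely generated. -/
def IsTwoRegular (s : ℕ → ℤ) : Prop :=
  (Submodule.span ℤ (kernel2 s)).FG

/-- A sequence is 2-automatic if its 2-kernel is finite. -/
def IsTwoAutomatic (s : ℕ → ℤ) : Prop :=
  (kernel2 s).Finite

/-- The period-doubling word, fixed point (starting with 0) of 0 ↦ 01, 1 ↦ 00:
its `n`-th letter is the parity of the 2-adic valuation of `n+1`. -/
def pd (n : ℕ) : ℕ := (n + 1).factorization 2 % 2

/-- The Thue–Morse word, fixed point (starting with 0) of 0 ↦ 01, 1 ↦ 10: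
its `n`-th letter is the parity of the binary digit sum of `n`. -/
def tm (n : ℕ) : ℕ := (Nat.digits 2 n).sum % 2

/-- The 2-block coding `x = block(p, 2)` of the period-doubling word. -/
def xw (n : ℕ) : ℕ := 2 * pd n + pd (n + 1)

/-- The 2-block coding `y = block(t, 2)` of the Thue–Morse word. -/
def yw (n : ℕ) : ℕ := 2 * tm n + tm (n + 1)

/-- The factor of an infinite word `w` of length `len` occurring at position `i`. -/
def factorAt (w : ℕ → ℕ) (i len : ℕ) : List ℕ :=
  (List.range len).map fun k => w (i + k)

/-- `u` is a factor of the infinite word `w`. -/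
def IsFactor (w : ℕ → ℕ) (u : List ℕ) : Prop :=
  ∃ i, u = factorAt w i u.length

/-- Maximal number of 0's in a factor of `x` of length `n`. -/
noncomputable def M0 (n : ℕ) : ℕ := sSup {k | ∃ i, (factorAt xw i n).count 0 = k}

/-- Minimal number of 0's in a factor of `x` of length `n`. -/
noncomputable def m0 (n : ℕ) : ℕ := sInf {k | ∃ i, (factorAt xw i n).count 0 = k}

noncomputable def D0 (n : ℕ) : ℕ := M0 n - m0 n

/-- Maximal number of 2's in a factor of `x` of length `n`. -/
noncomputable def M2c (n : ℕ) : ℕ := sSup {k | ∃ i, (factorAt xw i n).count 2 = k}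

/-- Minimal number of 2's in a factor of `x` of length `n`. -/
noncomputable def m2c (n : ℕ) : ℕ := sInf {k | ∃ i, (factorAt xw i n).count 2 = k}

/-- The max-jump function for `M0`. -/
noncomputable def JM0 : ℕ → ℕ
  | 0 => 0
  | n + 1 => if M0 n < M0 (n + 1) then 1 else 0

/-- The min-jump function for `m0`. -/
noncomputable def jm0 (n : ℕ) : ℕ := if m0 n < m0 (n + 1) then 1 else 0

/-- Maximal total number of 1's and 2's in a factor of `y` of length `n`. -/
noncomputable def M12 (n : ℕ) : ℕ :=
  sSup {k | ∃ i, (factorAt yw i n).count 1 + (factorAt yw i n).count 2 = k}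

/-- Minimal total number of 1's and 2's in a factor of `y` of length `n`. -/
noncomputable def m12 (n : ℕ) : ℕ :=
  sInf {k | ∃ i, (factorAt yw i n).count 1 + (factorAt yw i n).count 2 = k}

noncomputable def D12 (n : ℕ) : ℕ := M12 n - m12 n

/-- Maximal total number of 0's and 3's in a factor of `y` of length `n`. -/
noncomputable def M03 (n : ℕ) : ℕ :=
  sSup {k | ∃ i, (factorAt yw i n).count 0 + (factorAt yw i n).count 3 = k}

/-- Minimal total number of 0's and 3's in a factor of `y` of length `n`. -/
noncomputable def m03 (n : ℕ) : ℕ :=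
  sInf {k | ∃ i, (factorAt yw i n).count 0 + (factorAt yw i n).count 3 = k}

/-- The max-jump function for `M03`. -/
noncomputable def JM03 (n : ℕ) : ℕ := if M03 (n - 1) < M03 n then 1 else 0

/-- The min-jump function for `m03`. -/
noncomputable def jm03 (n : ℕ) : ℕ := if m03 n < m03 (n + 1) then 1 else 0

/-- Abelian complexity: the number of abelian equivalence classes (i.e. distinct
multisets of letters) of factors of `w` of length `n`. -/
noncomputable def abComplexity (w : ℕ → ℕ) (n : ℕ) : ℕ :=
  Set.ncard {m : Multiset ℕ | ∃ i, (↑(factorAt w i n) : Multiset ℕ) = m}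

/-- The number of occurrences of `v` as a factor of `u`. -/
def countFactor (u v : List ℕ) : ℕ :=
  ((List.range (u.length + 1 - v.length)).filter
    fun i => decide ((u.drop i).take v.length = v)).length

/-- 2-abelian complexity: the number of 2-abelian equivalence classes of factors of `w`
of length `n`, where two words are 2-abelian equivalent when every word of length at most 2
occurs equally often in both. -/
noncomputable def abel2Complexity (w : ℕ → ℕ) (n : ℕ) : ℕ :=
  Set.ncard {f : List ℕ → ℕ |
    ∃ i, f = fun v => if v.length ≤ 2 then countFactor (factorAt w i n) v else 0}

/-- The morphism φ : 0 ↦ 12, 1 ↦ 12, 2 ↦ 00. -/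
def phiL : ℕ → List ℕ
  | 0 => [1, 2]
  | 1 => [1, 2]
  | 2 => [0, 0]
  | _ => []

/-- The morphism τ : 0 ↦ 0, 1 ↦ 2, 2 ↦ 1. -/
def tauL : ℕ → ℕ
  | 1 => 2
  | 2 => 1
  | n => n

lemma pd_two_mul (n : ℕ) : pd (2 * n) = 0 := by
  have h : ¬ 2 ∣ 2 * n + 1 := by omega
  simp [pd, Nat.factorization_eq_zero_of_not_dvd h]

lemma pd_two_mul_add_one (n : ℕ) : (pd (2 * n + 1) : ℤ) = 1 - pd n := by
  have h : (2 * n + 1 + 1).factorization 2 = (n + 1).factorization 2 + 1 := by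
    rw [show 2 * n + 1 + 1 = 2 * (n + 1) by ring,
      Nat.factorization_mul (by norm_num) (by omega), Finsupp.add_apply,
      Nat.prime_two.factorization_self, add_comm]
  unfold pd
  rw [h]
  omega

lemma pd_lt_two (n : ℕ) : pd n < 2 := Nat.mod_lt _ two_pos

lemma pd_mul_pd_succ (n : ℕ) : pd n = 0 ∨ pd (n + 1) = 0 := by
  rcases Nat.even_or_odd' n with ⟨k, rfl | rfl⟩
  · exact Or.inl (pd_two_mul k)
  · exact Or.inr (pd_two_mul (k + 1))

/-- The number of ones in the factor of the period-doubling word of length `n` at position `i`. -/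
def windowSum (i n : ℕ) : ℤ := ∑ k ∈ Finset.range n, (pd (i + k) : ℤ)

lemma windowSum_succ (i n : ℕ) : windowSum i (n + 1) = windowSum i n + pd (i + n) :=
  Finset.sum_range_succ _ _

lemma windowSum_succ' (i n : ℕ) : windowSum i (n + 1) = pd i + windowSum (i + 1) n := by
  simp only [windowSum, Finset.sum_range_succ', add_zero]
  rw [add_comm]
  congr 1
  exact Finset.sum_congr rfl fun k _ => by rw [show i + (k + 1) = i + 1 + k by ring]

lemma windowSum_even_even (k m : ℕ) : windowSum (2 * k) (2 * m) = m - windowSum k m := by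
  induction m with
  | zero => simp [windowSum]
  | succ m ih =>
    rw [show 2 * (m + 1) = 2 * m + 1 + 1 by ring, windowSum_succ, windowSum_succ, ih,
      show 2 * k + (2 * m + 1) = 2 * (k + m) + 1 by ring, pd_two_mul_add_one,
      show 2 * k + 2 * m = 2 * (k + m) by ring, pd_two_mul, windowSum_succ]
    push_cast
    ring

lemma windowSum_even_odd (k m : ℕ) : windowSum (2 * k) (2 * m + 1) = m - windowSum k m := by
  rw [windowSum_succ, windowSum_even_even, ← mul_add, pd_two_mul]
  simp

lemma windowSum_odd (k n : ℕ) : windowSum (2 * k + 1) n = windowSum (2 * k) (n + 1) := by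
  rw [windowSum_succ', pd_two_mul]
  simp

lemma windowSum_odd_even (k m : ℕ) : windowSum (2 * k + 1) (2 * m) = m - windowSum k m := by
  rw [windowSum_odd, windowSum_even_odd]

lemma windowSum_odd_odd (k m : ℕ) :
    windowSum (2 * k + 1) (2 * m + 1) = m + 1 - windowSum k (m + 1) := by
  rw [windowSum_odd, show 2 * m + 1 + 1 = 2 * (m + 1) by ring, windowSum_even_even]
  push_cast
  ring

/-- The numbers of ones in the factors of length `n` of the period-doubling word. -/
def windowSums (n : ℕ) : Set ℤ := Set.range fun i => windowSum i n

lemma windowSum_mem (i n : ℕ) : windowSum i n ∈ windowSums n := ⟨i, rfl⟩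

lemma mem_windowSums_even (m : ℕ) (s : ℤ) :
    s ∈ windowSums (2 * m) ↔ (m : ℤ) - s ∈ windowSums m := by
  constructor
  · rintro ⟨i, rfl⟩
    rcases Nat.even_or_odd' i with ⟨k, rfl | rfl⟩
    · exact ⟨k, by simp [windowSum_even_even]⟩
    · exact ⟨k, by simp [windowSum_odd_even]⟩
  · rintro ⟨k, hk⟩
    refine ⟨2 * k, ?_⟩
    simp only [windowSum_even_even] at hk ⊢
    linarith

lemma mem_windowSums_odd (m : ℕ) (s : ℤ) :
    s ∈ windowSums (2 * m + 1) ↔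
      (m : ℤ) - s ∈ windowSums m ∨ (m : ℤ) + 1 - s ∈ windowSums (m + 1) := by
  constructor
  · rintro ⟨i, rfl⟩
    rcases Nat.even_or_odd' i with ⟨k, rfl | rfl⟩
    · exact Or.inl ⟨k, by simp [windowSum_even_odd]⟩
    · exact Or.inr ⟨k, by simp [windowSum_odd_odd]⟩
  · rintro (⟨k, hk⟩ | ⟨k, hk⟩)
    · refine ⟨2 * k, ?_⟩
      simp only [windowSum_even_odd] at hk ⊢
      linarith
    · refine ⟨2 * k + 1, ?_⟩
      simp only [windowSum_odd_odd] at hk ⊢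
      linarith

lemma mem_windowSums_succ_of_mem {n : ℕ} {s : ℤ} (h : s ∈ windowSums n) :
    s ∈ windowSums (n + 1) ∨ s + 1 ∈ windowSums (n + 1) := by
  obtain ⟨i, rfl⟩ := h
  have h1 := windowSum_succ i n
  have h2 := pd_lt_two (i + n)
  have h3 := windowSum_mem i (n + 1)
  rcases (show pd (i + n) = 0 ∨ pd (i + n) = 1 by omega) with h | h <;> simp_all

lemma mem_windowSums_of_mem_succ {n : ℕ} {s : ℤ} (h : s ∈ windowSums (n + 1)) :
    s ∈ windowSums n ∨ s - 1 ∈ windowSums n := by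
  obtain ⟨i, rfl⟩ := h
  have h1 := windowSum_succ i n
  have h2 := pd_lt_two (i + n)
  have h3 := windowSum_mem i n
  rcases (show pd (i + n) = 0 ∨ pd (i + n) = 1 by omega) with h | h <;> simp_all

lemma mem_windowSums_zero (s : ℤ) : s ∈ windowSums 0 ↔ s = 0 := by
  simp [windowSums, windowSum]

lemma mem_windowSums_one (s : ℤ) : s ∈ windowSums 1 ↔ s = 0 ∨ s = 1 := by
  constructor
  · rintro ⟨i, rfl⟩
    have := pd_lt_two i
    simp only [windowSum, Finset.sum_range_one, add_zero]
    omega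
  · have h0 := pd_two_mul 0
    have h1 := pd_two_mul_add_one 0
    rintro (rfl | rfl)
    · exact ⟨0, by simpa [windowSum] using h0⟩
    · exact ⟨1, by simp_all [windowSum]⟩

lemma exists_windowSums_eq_Icc (n : ℕ) : ∃ a b : ℤ, a ≤ b ∧ windowSums n = Set.Icc a b := by
  induction n using Nat.strong_induction_on with
  | _ n ih =>
    rcases Nat.even_or_odd' n with ⟨m, rfl | rfl⟩
    · rcases Nat.eq_zero_or_pos m with rfl | hm
      · refine ⟨0, 0, le_rfl, Set.ext fun s => ?_⟩
        rw [mul_zero, mem_windowSums_zero, Set.mem_Icc]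
        omega
      · obtain ⟨a, b, hab, h⟩ := ih m (by omega)
        refine ⟨m - b, m - a, by omega, Set.ext fun s => ?_⟩
        rw [mem_windowSums_even, h, Set.mem_Icc, Set.mem_Icc]
        omega
    · rcases Nat.eq_zero_or_pos m with rfl | hm
      · refine ⟨0, 1, by norm_num, Set.ext fun s => ?_⟩
        rw [mul_zero, zero_add, mem_windowSums_one, Set.mem_Icc]
        omega
      · obtain ⟨a, b, hab, h⟩ := ih m (by omega)
        obtain ⟨c, d, hcd, h'⟩ := ih (m + 1) (by omega)
        have ha := mem_windowSums_succ_of_mem (n := m) (s := a)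
        have hb := mem_windowSums_succ_of_mem (n := m) (s := b)
        have hc := mem_windowSums_of_mem_succ (n := m) (s := c)
        have hd := mem_windowSums_of_mem_succ (n := m) (s := d)
        simp only [h, h', Set.mem_Icc] at ha hb hc hd
        refine ⟨m - b, m + 1 - c, by omega, Set.ext fun s => ?_⟩
        rw [mem_windowSums_odd, h, h', Set.mem_Icc, Set.mem_Icc, Set.mem_Icc]
        omega

/-- The minimal number of ones in a factor of length `n` of the period-doubling word. -/
noncomputable def windowMin (n : ℕ) : ℤ := sInf (windowSums n)

/-- The maximal number of ones in a factor of length `n` of the period-doubling word. -/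
noncomputable def windowMax (n : ℕ) : ℤ := sSup (windowSums n)

lemma windowMin_le_windowMax (n : ℕ) : windowMin n ≤ windowMax n := by
  obtain ⟨a, b, hab, h⟩ := exists_windowSums_eq_Icc n
  rwa [windowMin, windowMax, h, csInf_Icc hab, csSup_Icc hab]

lemma mem_windowSums (n : ℕ) (s : ℤ) :
    s ∈ windowSums n ↔ windowMin n ≤ s ∧ s ≤ windowMax n := by
  obtain ⟨a, b, hab, h⟩ := exists_windowSums_eq_Icc n
  rw [windowMin, windowMax, h, csInf_Icc hab, csSup_Icc hab, Set.mem_Icc]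

lemma windowMin_even (m : ℕ) : windowMin (2 * m) = m - windowMax m := by
  have h := mem_windowSums_even m
  have h1 := windowMin_le_windowMax m
  have h2 := windowMin_le_windowMax (2 * m)
  simp only [mem_windowSums] at h
  have h3 := h (windowMin (2 * m))
  have h4 := h (m - windowMax m)
  omega

lemma windowMax_even (m : ℕ) : windowMax (2 * m) = m - windowMin m := by
  have h := mem_windowSums_even m
  have h1 := windowMin_le_windowMax m
  have h2 := windowMin_le_windowMax (2 * m)
  simp only [mem_windowSums] at h
  have h3 := h (windowMax (2 * m))
  have h4 := h (m - windowMin m)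
  omega

lemma windowMin_succ (n : ℕ) :
    windowMin n ≤ windowMin (n + 1) ∧ windowMin (n + 1) ≤ windowMin n + 1 := by
  have h1 := windowMin_le_windowMax n
  have h2 := windowMin_le_windowMax (n + 1)
  have h3 := mem_windowSums_succ_of_mem (n := n) (s := windowMin n)
  have h4 := mem_windowSums_of_mem_succ (n := n) (s := windowMin (n + 1))
  simp only [mem_windowSums] at h3 h4
  omega

lemma windowMax_succ (n : ℕ) :
    windowMax n ≤ windowMax (n + 1) ∧ windowMax (n + 1) ≤ windowMax n + 1 := by
  have h1 := windowMin_le_windowMax n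
  have h2 := windowMin_le_windowMax (n + 1)
  have h3 := mem_windowSums_succ_of_mem (n := n) (s := windowMax n)
  have h4 := mem_windowSums_of_mem_succ (n := n) (s := windowMax (n + 1))
  simp only [mem_windowSums] at h3 h4
  omega

lemma windowMin_odd (m : ℕ) : windowMin (2 * m + 1) = m - windowMax m := by
  have h := mem_windowSums_odd m
  have h1 := windowMin_le_windowMax m
  have h2 := windowMin_le_windowMax (2 * m + 1)
  have h3 := windowMax_succ m
  simp only [mem_windowSums] at h
  have h4 := h (windowMin (2 * m + 1))
  have h5 := h (m - windowMax m)
  omega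

lemma windowMax_odd (m : ℕ) : windowMax (2 * m + 1) = m + 1 - windowMin (m + 1) := by
  have h := mem_windowSums_odd m
  have h1 := windowMin_le_windowMax (m + 1)
  have h2 := windowMin_le_windowMax (2 * m + 1)
  have h3 := windowMin_succ m
  simp only [mem_windowSums] at h
  have h4 := h (windowMax (2 * m + 1))
  have h5 := h (m + 1 - windowMin (m + 1))
  omega

/-- The spread of the numbers of ones in the factors of length `n` of the period-doubling word. -/
noncomputable def windowSpread (n : ℕ) : ℤ := windowMax n - windowMin n

lemma windowSpread_nonneg (n : ℕ) : 0 ≤ windowSpread n :=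
  sub_nonneg.2 (windowMin_le_windowMax n)

lemma windowSpread_zero : windowSpread 0 = 0 := by
  have h : windowSums 0 = {0} := Set.ext mem_windowSums_zero
  simp [windowSpread, windowMin, windowMax, h]

lemma windowSpread_even (m : ℕ) : windowSpread (2 * m) = windowSpread m := by
  simp only [windowSpread, windowMin_even, windowMax_even]
  ring

lemma windowSpread_odd (m : ℕ) :
    windowSpread (2 * m + 1) = windowMax m - windowMin (m + 1) + 1 := by
  simp only [windowSpread, windowMin_odd, windowMax_odd]
  ring

lemma windowSpread_four_mul_add_one (m : ℕ) :
    windowSpread (4 * m + 1) = windowSpread m + 1 := by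
  rw [show 4 * m + 1 = 2 * (2 * m) + 1 by ring, windowSpread_odd, windowMax_even, windowMin_odd,
    windowSpread]
  ring

lemma windowSpread_four_mul_add_three (m : ℕ) :
    windowSpread (4 * m + 3) = windowSpread (m + 1) + 1 := by
  rw [show 4 * m + 3 = 2 * (2 * m + 1) + 1 by ring, windowSpread_odd, windowMax_odd,
    show 2 * m + 1 + 1 = 2 * (m + 1) by ring, windowMin_even, windowSpread]
  push_cast
  ring

/-- Factors of length `n` that are followed by 0. -/
lemma exists_windowSum_next_zero (n : ℕ) (s : ℤ) :
    (∃ i, pd (i + n) = 0 ∧ windowSum i n = s) ↔ windowMin (n + 1) ≤ s ∧ s ≤ windowMax n := by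
  constructor
  · rintro ⟨i, hi, rfl⟩
    have h1 := (mem_windowSums _ _).1 (windowSum_mem i n)
    have h2 := (mem_windowSums _ _).1 (windowSum_mem i (n + 1))
    rw [windowSum_succ, hi] at h2
    push_cast at h2
    omega
  · intro h
    rcases Nat.even_or_odd' n with ⟨j, rfl | rfl⟩
    · rw [windowMin_odd, windowMax_even] at h
      obtain ⟨k, hk⟩ := (mem_windowSums j (j - s)).2 (by omega)
      refine ⟨2 * k, by rw [← mul_add, pd_two_mul], ?_⟩
      simp only [windowSum_even_even] at hk ⊢
      linarith
    · rw [show 2 * j + 1 + 1 = 2 * (j + 1) by ring, windowMin_even, windowMax_odd] at h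
      obtain ⟨k, hk⟩ := (mem_windowSums (j + 1) (j + 1 - s)).2 (by push_cast at h; omega)
      refine ⟨2 * k + 1, ?_, ?_⟩
      · rw [show 2 * k + 1 + (2 * j + 1) = 2 * (k + j + 1) by ring, pd_two_mul]
      · simp only [windowSum_odd_odd] at hk ⊢
        linarith

/-- Factors of length `n + 1` that begin with 0. -/
lemma exists_windowSum_head_zero (n : ℕ) (s : ℤ) :
    (∃ i, pd i = 0 ∧ windowSum i (n + 1) = s) ↔ windowMin (n + 1) ≤ s ∧ s ≤ windowMax n := by
  constructor
  · rintro ⟨i, hi, rfl⟩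
    have h1 := (mem_windowSums _ _).1 (windowSum_mem (i + 1) n)
    have h2 := (mem_windowSums _ _).1 (windowSum_mem i (n + 1))
    rw [windowSum_succ', hi] at h2 ⊢
    push_cast at h2 ⊢
    omega
  · intro h
    rcases Nat.even_or_odd' n with ⟨j, rfl | rfl⟩
    · rw [windowMin_odd, windowMax_even] at h
      obtain ⟨k, hk⟩ := (mem_windowSums j (j - s)).2 (by omega)
      refine ⟨2 * k, pd_two_mul k, ?_⟩
      simp only [windowSum_even_odd] at hk ⊢
      linarith
    · rw [show 2 * j + 1 + 1 = 2 * (j + 1) by ring, windowMin_even, windowMax_odd] at h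
      obtain ⟨k, hk⟩ := (mem_windowSums (j + 1) (j + 1 - s)).2 (by push_cast at h; omega)
      refine ⟨2 * k, pd_two_mul k, ?_⟩
      rw [show 2 * j + 1 + 1 = 2 * (j + 1) by ring]
      simp only [windowSum_even_even] at hk ⊢
      push_cast
      linarith

/-- The pairs formed by the number of ones in a factor of length `n` of the period-doubling word
and the difference between the letter following that factor and its first letter. -/
def windowPairs (n : ℕ) : Set (ℤ × ℤ) :=
  Set.range fun i => (windowSum i n, (pd (i + n) : ℤ) - pd i)

lemma mem_windowPairs_one_even (m : ℕ) (s : ℤ) :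
    (s, 1) ∈ windowPairs (2 * m) ↔ ((m : ℤ) - s, -1) ∈ windowPairs m := by
  constructor
  · rintro ⟨i, hi⟩
    rw [Prod.mk.injEq] at hi
    rcases Nat.even_or_odd' i with ⟨k, rfl | rfl⟩
    · rw [← mul_add, pd_two_mul, pd_two_mul] at hi
      omega
    · rw [show 2 * k + 1 + 2 * m = 2 * (k + m) + 1 by ring, pd_two_mul_add_one,
        pd_two_mul_add_one, windowSum_odd_even] at hi
      refine ⟨k, Prod.ext ?_ ?_⟩ <;> dsimp only <;> omega
  · rintro ⟨k, hk⟩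
    rw [Prod.mk.injEq] at hk
    refine ⟨2 * k + 1, Prod.ext ?_ ?_⟩ <;> dsimp only
    · rw [windowSum_odd_even]
      omega
    · rw [show 2 * k + 1 + 2 * m = 2 * (k + m) + 1 by ring, pd_two_mul_add_one,
        pd_two_mul_add_one]
      omega

lemma mem_windowPairs_neg_one_even (m : ℕ) (s : ℤ) :
    (s, -1) ∈ windowPairs (2 * m) ↔ ((m : ℤ) - s, 1) ∈ windowPairs m := by
  constructor
  · rintro ⟨i, hi⟩
    rw [Prod.mk.injEq] at hi
    rcases Nat.even_or_odd' i with ⟨k, rfl | rfl⟩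
    · rw [← mul_add, pd_two_mul, pd_two_mul] at hi
      omega
    · rw [show 2 * k + 1 + 2 * m = 2 * (k + m) + 1 by ring, pd_two_mul_add_one,
        pd_two_mul_add_one, windowSum_odd_even] at hi
      refine ⟨k, Prod.ext ?_ ?_⟩ <;> dsimp only <;> omega
  · rintro ⟨k, hk⟩
    rw [Prod.mk.injEq] at hk
    refine ⟨2 * k + 1, Prod.ext ?_ ?_⟩ <;> dsimp only
    · rw [windowSum_odd_even]
      omega
    · rw [show 2 * k + 1 + 2 * m = 2 * (k + m) + 1 by ring, pd_two_mul_add_one,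
        pd_two_mul_add_one]
      omega

lemma mem_windowPairs_one_odd (m : ℕ) (s : ℤ) :
    (s, 1) ∈ windowPairs (2 * m + 1) ↔ ∃ i, pd (i + m) = 0 ∧ windowSum i m = m - s := by
  constructor
  · rintro ⟨i, hi⟩
    rw [Prod.mk.injEq] at hi
    rcases Nat.even_or_odd' i with ⟨k, rfl | rfl⟩
    · rw [show 2 * k + (2 * m + 1) = 2 * (k + m) + 1 by ring, pd_two_mul_add_one,
        pd_two_mul, windowSum_even_odd] at hi
      exact ⟨k, by omega, by omega⟩
    · rw [show 2 * k + 1 + (2 * m + 1) = 2 * (k + m + 1) by ring, pd_two_mul] at hi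
      omega
  · rintro ⟨k, hk, hs⟩
    refine ⟨2 * k, Prod.ext ?_ ?_⟩ <;> dsimp only
    · rw [windowSum_even_odd]
      omega
    · rw [show 2 * k + (2 * m + 1) = 2 * (k + m) + 1 by ring, pd_two_mul_add_one, pd_two_mul]
      omega

lemma mem_windowPairs_neg_one_odd (m : ℕ) (s : ℤ) :
    (s, -1) ∈ windowPairs (2 * m + 1) ↔ ∃ i, pd i = 0 ∧ windowSum i (m + 1) = m + 1 - s := by
  constructor
  · rintro ⟨i, hi⟩
    rw [Prod.mk.injEq] at hi
    rcases Nat.even_or_odd' i with ⟨k, rfl | rfl⟩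
    · rw [pd_two_mul] at hi
      omega
    · rw [show 2 * k + 1 + (2 * m + 1) = 2 * (k + m + 1) by ring, pd_two_mul,
        pd_two_mul_add_one, windowSum_odd_odd] at hi
      exact ⟨k, by omega, by omega⟩
  · rintro ⟨k, hk, hs⟩
    refine ⟨2 * k + 1, Prod.ext ?_ ?_⟩ <;> dsimp only
    · rw [windowSum_odd_odd]
      omega
    · rw [show 2 * k + 1 + (2 * m + 1) = 2 * (k + m + 1) by ring, pd_two_mul,
        pd_two_mul_add_one]
      omega

lemma mem_windowPairs_one_and_neg_one (n : ℕ) :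
    (∀ s, (s, 1) ∈ windowPairs n ↔ windowMin n ≤ s ∧ s ≤ windowMax n - 1) ∧
      ∀ s, (s, -1) ∈ windowPairs n ↔ windowMin n + 1 ≤ s ∧ s ≤ windowMax n := by
  induction n using Nat.strong_induction_on with
  | _ n ih =>
    rcases Nat.even_or_odd' n with ⟨m, rfl | rfl⟩
    · rcases Nat.eq_zero_or_pos m with rfl | hm
      · have h := windowSpread_zero
        unfold windowSpread at h
        simp only [mul_zero, windowPairs, add_zero, sub_self, Set.mem_range, Prod.mk.injEq]
        refine ⟨fun s => ?_, fun s => ?_⟩ <;>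
          exact ⟨fun ⟨_, _, h'⟩ => by omega, fun h' => by omega⟩
      · simp only [mem_windowPairs_one_even, mem_windowPairs_neg_one_even, (ih m (by omega)).1,
          (ih m (by omega)).2, windowMin_even, windowMax_even]
        exact ⟨fun s => by omega, fun s => by omega⟩
    · simp only [mem_windowPairs_one_odd, mem_windowPairs_neg_one_odd, windowMin_odd,
        windowMax_odd, exists_windowSum_next_zero, exists_windowSum_head_zero]
      exact ⟨fun s => by omega, fun s => by omega⟩

lemma mem_windowPairs_zero_even (m : ℕ) (s : ℤ) :
    (s, 0) ∈ windowPairs (2 * m) ↔ windowMin (2 * m) ≤ s ∧ s ≤ windowMax (2 * m) := by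
  rw [← mem_windowSums]
  constructor
  · rintro ⟨i, hi⟩
    exact ⟨i, (Prod.mk.inj hi).1⟩
  · rw [mem_windowSums_even]
    rintro ⟨k, hk⟩
    refine ⟨2 * k, Prod.ext ?_ ?_⟩ <;> dsimp only at hk ⊢
    · rw [windowSum_even_even]
      omega
    · rw [← mul_add, pd_two_mul, pd_two_mul, sub_self]

lemma mem_windowPairs_zero_odd (m : ℕ) (s : ℤ) :
    (s, 0) ∈ windowPairs (2 * m + 1) ↔
      (∃ i, pd (i + m) = 1 ∧ windowSum i m = m - s) ∨
        ∃ i, pd i = 1 ∧ windowSum i (m + 1) = m + 1 - s := by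
  constructor
  · rintro ⟨i, hi⟩
    rw [Prod.mk.injEq] at hi
    rcases Nat.even_or_odd' i with ⟨k, rfl | rfl⟩
    · rw [show 2 * k + (2 * m + 1) = 2 * (k + m) + 1 by ring, pd_two_mul_add_one,
        pd_two_mul, windowSum_even_odd] at hi
      exact Or.inl ⟨k, by omega, by omega⟩
    · rw [show 2 * k + 1 + (2 * m + 1) = 2 * (k + m + 1) by ring, pd_two_mul,
        pd_two_mul_add_one, windowSum_odd_odd] at hi
      exact Or.inr ⟨k, by omega, by omega⟩
  · rintro (⟨k, hk, hs⟩ | ⟨k, hk, hs⟩)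
    · refine ⟨2 * k, Prod.ext ?_ ?_⟩ <;> dsimp only
      · rw [windowSum_even_odd]
        omega
      · rw [show 2 * k + (2 * m + 1) = 2 * (k + m) + 1 by ring, pd_two_mul_add_one, pd_two_mul]
        omega
    · refine ⟨2 * k + 1, Prod.ext ?_ ?_⟩ <;> dsimp only
      · rw [windowSum_odd_odd]
        omega
      · rw [show 2 * k + 1 + (2 * m + 1) = 2 * (k + m + 1) by ring, pd_two_mul,
          pd_two_mul_add_one]
        omega

lemma exists_windowSum_next_one_even (k : ℕ) (s : ℤ) :
    (∃ i, pd (i + 2 * k) = 1 ∧ windowSum i (2 * k) = s) ↔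
      ∃ i, pd (i + k) = 0 ∧ windowSum i k = k - s := by
  constructor
  · rintro ⟨i, hi, hs⟩
    rcases Nat.even_or_odd' i with ⟨q, rfl | rfl⟩
    · rw [← mul_add, pd_two_mul] at hi
      omega
    · have h := pd_two_mul_add_one (q + k)
      rw [show 2 * q + 1 + 2 * k = 2 * (q + k) + 1 by ring] at hi
      rw [windowSum_odd_even] at hs
      exact ⟨q, by omega, by omega⟩
  · rintro ⟨q, hq, hs⟩
    have h := pd_two_mul_add_one (q + k)
    refine ⟨2 * q + 1, ?_, ?_⟩
    · rw [show 2 * q + 1 + 2 * k = 2 * (q + k) + 1 by ring]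
      omega
    · rw [windowSum_odd_even]
      omega

lemma exists_windowSum_next_one_odd (k : ℕ) (s : ℤ) :
    (∃ i, pd (i + (2 * k + 1)) = 1 ∧ windowSum i (2 * k + 1) = s) ↔
      ∃ i, pd (i + k) = 0 ∧ windowSum i k = k - s := by
  constructor
  · rintro ⟨i, hi, hs⟩
    rcases Nat.even_or_odd' i with ⟨q, rfl | rfl⟩
    · have h := pd_two_mul_add_one (q + k)
      rw [show 2 * q + (2 * k + 1) = 2 * (q + k) + 1 by ring] at hi
      rw [windowSum_even_odd] at hs
      exact ⟨q, by omega, by omega⟩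
    · rw [show 2 * q + 1 + (2 * k + 1) = 2 * (q + k + 1) by ring, pd_two_mul] at hi
      omega
  · rintro ⟨q, hq, hs⟩
    have h := pd_two_mul_add_one (q + k)
    refine ⟨2 * q, ?_, ?_⟩
    · rw [show 2 * q + (2 * k + 1) = 2 * (q + k) + 1 by ring]
      omega
    · rw [windowSum_even_odd]
      omega

lemma exists_windowSum_head_one_odd (k : ℕ) (s : ℤ) :
    (∃ i, pd i = 1 ∧ windowSum i (2 * k + 1) = s) ↔
      ∃ i, pd i = 0 ∧ windowSum i (k + 1) = k + 1 - s := by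
  constructor
  · rintro ⟨i, hi, hs⟩
    rcases Nat.even_or_odd' i with ⟨q, rfl | rfl⟩
    · rw [pd_two_mul] at hi
      omega
    · have h := pd_two_mul_add_one q
      rw [windowSum_odd_odd] at hs
      exact ⟨q, by omega, by omega⟩
  · rintro ⟨q, hq, hs⟩
    have h := pd_two_mul_add_one q
    refine ⟨2 * q + 1, by omega, ?_⟩
    rw [windowSum_odd_odd]
    omega

lemma exists_windowSum_head_one_even (k : ℕ) (s : ℤ) :
    (∃ i, pd i = 1 ∧ windowSum i (2 * k) = s) ↔
      ∃ i, pd i = 0 ∧ windowSum i k = k - s := by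
  constructor
  · rintro ⟨i, hi, hs⟩
    rcases Nat.even_or_odd' i with ⟨q, rfl | rfl⟩
    · rw [pd_two_mul] at hi
      omega
    · have h := pd_two_mul_add_one q
      rw [windowSum_odd_even] at hs
      exact ⟨q, by omega, by omega⟩
  · rintro ⟨q, hq, hs⟩
    have h := pd_two_mul_add_one q
    refine ⟨2 * q + 1, by omega, ?_⟩
    rw [windowSum_odd_even]
    omega

lemma mem_windowPairs_zero_four_mul_add_one (k : ℕ) (s : ℤ) :
    (s, 0) ∈ windowPairs (4 * k + 1) ↔ windowMin (k + 1) + k ≤ s ∧ s ≤ windowMax k + k := by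
  rw [show 4 * k + 1 = 2 * (2 * k) + 1 by ring, mem_windowPairs_zero_odd,
    exists_windowSum_next_one_even, exists_windowSum_head_one_odd, exists_windowSum_next_zero,
    exists_windowSum_head_zero]
  push_cast
  omega

lemma mem_windowPairs_zero_four_mul_add_three (k : ℕ) (s : ℤ) :
    (s, 0) ∈ windowPairs (4 * k + 3) ↔
      windowMin (k + 1) + k + 1 ≤ s ∧ s ≤ windowMax k + k + 1 := by
  rw [show 4 * k + 3 = 2 * (2 * k + 1) + 1 by ring, mem_windowPairs_zero_odd,
    exists_windowSum_next_one_odd, show 2 * k + 1 + 1 = 2 * (k + 1) by ring,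
    exists_windowSum_head_one_even, exists_windowSum_next_zero, exists_windowSum_head_zero]
  push_cast
  omega

lemma count_two_factorAt (i n : ℕ) : ((factorAt xw i n).count 2 : ℤ) = windowSum i n := by
  induction n with
  | zero => simp [factorAt, windowSum]
  | succ n ih =>
    rw [windowSum_succ, ← ih]
    have h1 := pd_lt_two (i + n)
    have h2 := pd_lt_two (i + n + 1)
    have h3 := pd_mul_pd_succ (i + n)
    have h4 : xw (i + n) = 2 ↔ pd (i + n) = 1 := by unfold xw; omega
    simp only [factorAt, List.range_succ, List.map_append, List.count_append, List.map_cons,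
      List.map_nil, List.count_singleton, beq_iff_eq, h4]
    split_ifs <;> omega

lemma count_one_factorAt (i n : ℕ) :
    ((factorAt xw i n).count 1 : ℤ) = windowSum (i + 1) n := by
  induction n with
  | zero => simp [factorAt, windowSum]
  | succ n ih =>
    rw [windowSum_succ, ← ih, add_right_comm]
    have h1 := pd_lt_two (i + n)
    have h2 := pd_lt_two (i + n + 1)
    have h3 := pd_mul_pd_succ (i + n)
    have h4 : xw (i + n) = 1 ↔ pd (i + n + 1) = 1 := by unfold xw; omega
    simp only [factorAt, List.range_succ, List.map_append, List.count_append, List.map_cons,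
      List.map_nil, List.count_singleton, beq_iff_eq, h4]
    split_ifs <;> omega

lemma count_zero_factorAt (i n : ℕ) :
    ((factorAt xw i n).count 0 : ℤ) = n - windowSum i n - windowSum (i + 1) n := by
  induction n with
  | zero => simp [factorAt, windowSum]
  | succ n ih =>
    have h1 := pd_lt_two (i + n)
    have h2 := pd_lt_two (i + n + 1)
    have h3 := pd_mul_pd_succ (i + n)
    have h4 : xw (i + n) = 0 ↔ pd (i + n) = 0 ∧ pd (i + n + 1) = 0 := by unfold xw; omega
    have h5 := windowSum_succ i n
    have h6 := windowSum_succ (i + 1) n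
    rw [add_right_comm] at h6
    simp only [factorAt] at ih
    simp only [factorAt, List.range_succ, List.map_append, List.count_append, List.map_cons,
      List.map_nil, List.count_singleton, beq_iff_eq, h4]
    split_ifs <;> push_cast <;> omega

lemma count_factorAt_of_two_lt (i n : ℕ) {a : ℕ} (ha : 2 < a) :
    (factorAt xw i n).count a = 0 := by
  rw [List.count_eq_zero]
  intro h
  obtain ⟨k, -, hk⟩ := List.mem_map.1 h
  have h1 := pd_lt_two (i + k)
  have h3 := pd_mul_pd_succ (i + k)
  have h2 := pd_lt_two (i + k + 1)
  unfold xw at hk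
  omega

/-- Two factors of `xw` of equal length are abelian equivalent exactly when they yield the same
element of `windowPairs`. -/
lemma factorAt_eq_iff (i j n : ℕ) :
    (factorAt xw i n : Multiset ℕ) = factorAt xw j n ↔
      (windowSum i n, (pd (i + n) : ℤ) - pd i) = (windowSum j n, (pd (j + n) : ℤ) - pd j) := by
  have hi := windowSum_succ i n
  have hj := windowSum_succ j n
  rw [windowSum_succ'] at hi hj
  have hi0 := count_zero_factorAt i n
  have hj0 := count_zero_factorAt j n
  have hi1 := count_one_factorAt i n
  have hj1 := count_one_factorAt j n
  have hi2 := count_two_factorAt i n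
  have hj2 := count_two_factorAt j n
  rw [Multiset.coe_eq_coe, List.perm_iff_count, Prod.mk.injEq]
  constructor
  · intro h
    rw [h 1] at hi1
    rw [h 2] at hi2
    omega
  · rintro ⟨h1, h2⟩ a
    rcases (show a = 0 ∨ a = 1 ∨ a = 2 ∨ 2 < a by omega) with rfl | rfl | rfl | ha
    · omega
    · omega
    · omega
    · rw [count_factorAt_of_two_lt i n ha, count_factorAt_of_two_lt j n ha]

lemma abComplexity_xw_eq_ncard (n : ℕ) : abComplexity xw n = (windowPairs n).ncard := by
  let f : ℕ → Multiset ℕ := fun i => factorAt xw i n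
  let g : ℕ → ℤ × ℤ := fun i => (windowSum i n, (pd (i + n) : ℤ) - pd i)
  have hfg : ∀ i j, f i = f j ↔ g i = g j := fun i j => factorAt_eq_iff i j n
  refine Set.ncard_congr (fun m hm => g hm.choose) (fun m hm => ⟨_, rfl⟩) ?_ ?_
  · intro m m' hm hm' h
    rw [← hfg] at h
    exact hm.choose_spec.symm.trans (h.trans hm'.choose_spec)
  · rintro _ ⟨i, rfl⟩
    refine ⟨f i, ⟨i, rfl⟩, (hfg _ _).1 ?_⟩
    exact Exists.choose_spec (p := fun j => f j = f i) ⟨i, rfl⟩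

/-- The abelian complexity of `xw` when the factors `u` with equal first letter of `u` and letter
following `u` have their numbers of ones filling the interval from `a` to `b`. -/
lemma abComplexity_xw_of_zero_Icc {n : ℕ} {a b : ℤ} (hab : a ≤ b + 1)
    (h : ∀ s, (s, 0) ∈ windowPairs n ↔ a ≤ s ∧ s ≤ b) :
    (abComplexity xw n : ℤ) = 2 * windowSpread n + (b - a + 1) := by
  have hn := windowMin_le_windowMax n
  have heq : windowPairs n =
      ((Finset.Icc a b ×ˢ {0} ∪ Finset.Icc (windowMin n) (windowMax n - 1) ×ˢ {1}) ∪
        Finset.Icc (windowMin n + 1) (windowMax n) ×ˢ {-1} : Finset (ℤ × ℤ)) := by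
    ext ⟨s, d⟩
    have hd : (s, d) ∈ windowPairs n → d = 0 ∨ d = 1 ∨ d = -1 := by
      rintro ⟨i, hi⟩
      have h1 := pd_lt_two i
      have h2 := pd_lt_two (i + n)
      have h3 := (Prod.mk.inj hi).2
      omega
    simp only [Finset.coe_union, Set.mem_union, Finset.mem_coe, Finset.mem_product,
      Finset.mem_Icc, Finset.mem_singleton, ← h, ← (mem_windowPairs_one_and_neg_one n).1,
      ← (mem_windowPairs_one_and_neg_one n).2]
    constructor
    · intro hs
      rcases hd hs with rfl | rfl | rfl <;> simp [hs]
    · rintro ((⟨hs, rfl⟩ | ⟨hs, rfl⟩) | ⟨hs, rfl⟩) <;> exact hs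
  rw [abComplexity_xw_eq_ncard, heq, Set.ncard_coe_finset, Finset.card_union_of_disjoint,
    Finset.card_union_of_disjoint]
  · simp only [Finset.card_product, Finset.card_singleton, mul_one, Int.card_Icc, windowSpread]
    push_cast
    omega
  · rw [Finset.disjoint_left]
    rintro ⟨s, d⟩
    simp only [Finset.mem_product, Finset.mem_singleton]
    omega
  · rw [Finset.disjoint_left]
    rintro ⟨s, d⟩
    simp only [Finset.mem_union, Finset.mem_product, Finset.mem_singleton]
    omega

lemma abComplexity_xw_even (m : ℕ) :
    (abComplexity xw (2 * m) : ℤ) = 3 * windowSpread m + 1 := by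
  have h := windowMin_le_windowMax (2 * m)
  rw [abComplexity_xw_of_zero_Icc (by omega) (mem_windowPairs_zero_even m), ← windowSpread,
    windowSpread_even]
  ring

lemma abComplexity_xw_four_mul_add_one (k : ℕ) :
    (abComplexity xw (4 * k + 1) : ℤ) =
      2 * windowSpread (4 * k + 1) + windowSpread (2 * k + 1) := by
  have h := windowSpread_odd k
  have h' := windowSpread_nonneg (2 * k + 1)
  rw [abComplexity_xw_of_zero_Icc (by omega) (mem_windowPairs_zero_four_mul_add_one k)]
  omega

lemma abComplexity_xw_four_mul_add_three (k : ℕ) :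
    (abComplexity xw (4 * k + 3) : ℤ) =
      2 * windowSpread (4 * k + 3) + windowSpread (2 * k + 1) := by
  have h := windowSpread_odd k
  have h' := windowSpread_nonneg (2 * k + 1)
  rw [abComplexity_xw_of_zero_Icc (by omega) (mem_windowPairs_zero_four_mul_add_three k)]
  omega

lemma windowSpread_one : windowSpread 1 = 1 := by
  simpa [windowSpread_zero] using windowSpread_four_mul_add_one 0

lemma windowSpread_three : windowSpread 3 = 2 := by
  simpa [windowSpread_one] using windowSpread_four_mul_add_three 0

lemma exists_eq_even_or_four_mul_add (n : ℕ) :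
    ∃ k, n = 2 * k ∨ n = 4 * k + 1 ∨ n = 4 * k + 3 := by
  rcases (show n % 2 = 0 ∨ n % 4 = 1 ∨ n % 4 = 3 by omega) with h | h | h
  · exact ⟨n / 2, by omega⟩
  · exact ⟨n / 4, by omega⟩
  · exact ⟨n / 4, by omega⟩

lemma windowSpread_two_pow_add (l : ℕ) :
    ∀ r, 2 * r ≤ 2 ^ l → windowSpread (2 ^ l + r) = windowSpread r + 1 := by
  induction l using Nat.strong_induction_on with
  | _ l ih =>
    intro r hr
    obtain _ | _ | l := l
    · obtain rfl : r = 0 := by omega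
      simp [windowSpread_zero, windowSpread_one]
    · rcases (show r = 0 ∨ r = 1 by omega) with rfl | rfl
      · simpa [windowSpread_zero, windowSpread_one] using windowSpread_even 1
      · simp [windowSpread_one, windowSpread_three]
    · have e1 : 2 ^ (l + 1) = 2 * 2 ^ l := by ring
      have e2 : 2 ^ (l + 2) = 4 * 2 ^ l := by ring
      rw [e2] at hr ⊢
      obtain ⟨k, rfl | rfl | rfl⟩ := exists_eq_even_or_four_mul_add r
      · rw [show 4 * 2 ^ l + 2 * k = 2 * (2 ^ (l + 1) + k) by omega, windowSpread_even,
          windowSpread_even, ih (l + 1) (by omega) k (by omega)]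
      · rw [show 4 * 2 ^ l + (4 * k + 1) = 4 * (2 ^ l + k) + 1 by ring,
          windowSpread_four_mul_add_one, windowSpread_four_mul_add_one,
          ih l (by omega) k (by omega)]
      · obtain _ | l := l
        · omega
        · have e3 : 2 ^ (l + 1) = 2 * 2 ^ l := by ring
          rw [show 4 * 2 ^ (l + 1) + (4 * k + 3) = 4 * (2 ^ (l + 1) + k) + 3 by ring,
            windowSpread_four_mul_add_three, windowSpread_four_mul_add_three, add_assoc,
            ih (l + 1) (by omega) (k + 1) (by omega)]

lemma windowSpread_reflect (l : ℕ) :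
    ∀ i j, 2 ^ l ≤ i → 2 ^ l ≤ j → i + j = 3 * 2 ^ l → windowSpread i = windowSpread j := by
  induction l using Nat.strong_induction_on with
  | _ l ih =>
    intro i j hi hj hij
    have h12 : windowSpread 2 = windowSpread 1 := windowSpread_even 1
    obtain _ | _ | l := l
    · rcases (show i = 1 ∧ j = 2 ∨ i = 2 ∧ j = 1 by omega) with ⟨rfl, rfl⟩ | ⟨rfl, rfl⟩ <;>
        simp [h12]
    · have h24 : windowSpread 4 = windowSpread 2 := windowSpread_even 2
      rcases (show i = 2 ∧ j = 4 ∨ i = 4 ∧ j = 2 ∨ i = 3 ∧ j = 3 by omega) with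
        ⟨rfl, rfl⟩ | ⟨rfl, rfl⟩ | ⟨rfl, rfl⟩ <;> simp [h24]
    · have e1 : 2 ^ (l + 1) = 2 * 2 ^ l := by ring
      have e2 : 2 ^ (l + 2) = 4 * 2 ^ l := by ring
      rw [e2] at hi hj hij
      obtain ⟨k, rfl | rfl | rfl⟩ := exists_eq_even_or_four_mul_add i <;>
        obtain ⟨k', rfl | rfl | rfl⟩ := exists_eq_even_or_four_mul_add j
      · rw [windowSpread_even, windowSpread_even]
        exact ih (l + 1) (by omega) _ _ (by omega) (by omega) (by omega)
      any_goals omega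
      · rw [windowSpread_four_mul_add_one, windowSpread_four_mul_add_three,
          ih l (by omega) k (k' + 1) (by omega) (by omega) (by omega)]
      · rw [windowSpread_four_mul_add_one, windowSpread_four_mul_add_three,
          ih l (by omega) (k + 1) k' (by omega) (by omega) (by omega)]

lemma abComplexity_xw_two_pow_add {l r : ℕ} (hl : 2 ≤ l) (hr : 2 * r ≤ 2 ^ l) :
    abComplexity xw (2 ^ l + r) = abComplexity xw r + 3 := by
  obtain ⟨l, rfl⟩ := Nat.exists_eq_add_of_le' hl
  have e1 : 2 ^ (l + 1) = 2 * 2 ^ l := by ring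
  have e2 : 2 ^ (l + 2) = 4 * 2 ^ l := by ring
  have hD := windowSpread_two_pow_add (l + 2) r hr
  have hD' := windowSpread_two_pow_add (l + 1)
  rw [← Nat.cast_inj (R := ℤ)]
  push_cast
  rw [e1] at hD'
  rw [e2] at hD hr ⊢
  obtain ⟨k, rfl | rfl | rfl⟩ := exists_eq_even_or_four_mul_add r
  · rw [show 4 * 2 ^ l + 2 * k = 2 * (2 * 2 ^ l + k) by ring, abComplexity_xw_even,
      abComplexity_xw_even, hD' k (by omega)]
    ring
  · rw [show 4 * 2 ^ l + (4 * k + 1) = 4 * (2 ^ l + k) + 1 by ring] at hD ⊢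
    rw [abComplexity_xw_four_mul_add_one, abComplexity_xw_four_mul_add_one, hD,
      show 2 * (2 ^ l + k) + 1 = 2 * 2 ^ l + (2 * k + 1) by ring]
    obtain _ | l := l
    · obtain rfl : k = 0 := by omega
      simp [windowSpread_one, windowSpread_three]
    · have e3 : 2 ^ (l + 1) = 2 * 2 ^ l := by ring
      rw [hD' (2 * k + 1) (by omega)]
      ring
  · rw [show 4 * 2 ^ l + (4 * k + 3) = 4 * (2 ^ l + k) + 3 by ring] at hD ⊢
    rw [abComplexity_xw_four_mul_add_three, abComplexity_xw_four_mul_add_three, hD,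
      show 2 * (2 ^ l + k) + 1 = 2 * 2 ^ l + (2 * k + 1) by ring, hD' (2 * k + 1) (by omega)]
    ring

lemma abComplexity_xw_reflect {l i j : ℕ} (hl : 2 ≤ l) (hi : 2 ^ l ≤ i) (hj : 2 ^ l ≤ j)
    (hij : i + j = 3 * 2 ^ l) : abComplexity xw i = abComplexity xw j := by
  obtain ⟨l, rfl⟩ := Nat.exists_eq_add_of_le' hl
  have e1 : 2 ^ (l + 1) = 2 * 2 ^ l := by ring
  have e2 : 2 ^ (l + 2) = 4 * 2 ^ l := by ring
  have hD := windowSpread_reflect (l + 2) i j hi hj hij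
  have hD' := windowSpread_reflect (l + 1)
  rw [← Nat.cast_inj (R := ℤ)]
  rw [e1] at hD'
  rw [e2] at hi hj hij
  obtain ⟨k, rfl | rfl | rfl⟩ := exists_eq_even_or_four_mul_add i <;>
    obtain ⟨k', rfl | rfl | rfl⟩ := exists_eq_even_or_four_mul_add j
  · rw [abComplexity_xw_even, abComplexity_xw_even,
      hD' k k' (by omega) (by omega) (by omega)]
  any_goals omega
  · rw [abComplexity_xw_four_mul_add_one, abComplexity_xw_four_mul_add_three, hD,
      hD' (2 * k + 1) (2 * k' + 1) (by omega) (by omega) (by omega)]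
  · rw [abComplexity_xw_four_mul_add_one, abComplexity_xw_four_mul_add_three, hD,
      hD' (2 * k + 1) (2 * k' + 1) (by omega) (by omega) (by omega)]

/-- A sequence lying in a finitely generated module of sequences that is stable under
`t ↦ t (2 n)` and `t ↦ t (2 n + 1)` is 2-regular. -/
lemma IsTwoRegular.of_stable {s : ℕ → ℤ} {V : Submodule ℤ (ℕ → ℤ)} (hV : V.FG) (hs : s ∈ V)
    (h0 : ∀ t ∈ V, (fun n => t (2 * n)) ∈ V) (h1 : ∀ t ∈ V, (fun n => t (2 * n + 1)) ∈ V) :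
    IsTwoRegular s := by
  have key : ∀ i j, j < 2 ^ i → ∀ t ∈ V, (fun n => t (2 ^ i * n + j)) ∈ V := by
    intro i
    induction i with
    | zero =>
      intro j hj t ht
      obtain rfl : j = 0 := by omega
      simpa using ht
    | succ i ih =>
      intro j hj t ht
      rw [pow_succ] at hj
      rcases Nat.even_or_odd' j with ⟨k, rfl | rfl⟩
      · convert ih k (by omega) _ (h0 t ht) using 3
        ring
      · convert ih k (by omega) _ (h1 t ht) using 3
        ring
  have hle : Submodule.span ℤ (kernel2 s) ≤ V := by
    rw [Submodule.span_le]
    rintro _ ⟨i, j, hj, rfl⟩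
    exact key i j hj s hs
  exact hV.of_le hle

lemma isTwoRegular_abComplexity_xw : IsTwoRegular fun n => (abComplexity xw n : ℤ) := by
  let C : ℕ → ℤ := fun n => abComplexity xw n
  let H : ℕ → ℤ := fun n => abComplexity xw (2 * n + 1)
  let F : ℕ → ℤ := fun n => windowSpread (n + 1)
  let E : ℕ → ℤ := fun n => windowSpread (2 * n + 1)
  let B : Set (ℕ → ℤ) := {C, H, windowSpread, F, E, 1}
  let V := Submodule.span ℤ B
  have hB : B.Finite := by simp [B]
  have hC : C ∈ V := Submodule.subset_span (by simp [B])
  have hH : H ∈ V := Submodule.subset_span (by simp [B])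
  have hD : windowSpread ∈ V := Submodule.subset_span (by simp [B])
  have hF : F ∈ V := Submodule.subset_span (by simp [B])
  have hE : E ∈ V := Submodule.subset_span (by simp [B])
  have h1 : (1 : ℕ → ℤ) ∈ V := Submodule.subset_span (by simp [B])
  have stable : ∀ f : (ℕ → ℤ) →ₗ[ℤ] (ℕ → ℤ), (∀ t ∈ B, f t ∈ V) → ∀ t ∈ V, f t ∈ V :=
    fun f hf t ht => Submodule.span_le (p := V.comap f).2 hf ht
  refine IsTwoRegular.of_stable (V := V) (Submodule.fg_span hB) hC
    (stable (LinearMap.funLeft ℤ ℤ fun n => 2 * n) ?_)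
    (stable (LinearMap.funLeft ℤ ℤ fun n => 2 * n + 1) ?_)
  · rintro t (rfl | rfl | rfl | rfl | rfl | rfl)
    · convert V.add_mem (V.smul_mem 3 hD) h1 using 1
      ext n
      simpa [C, LinearMap.funLeft_apply] using abComplexity_xw_even n
    · convert V.add_mem (V.add_mem (V.smul_mem 2 hD) (V.smul_mem 2 h1)) hE using 1
      ext n
      have h := abComplexity_xw_four_mul_add_one n
      rw [windowSpread_four_mul_add_one, show 4 * n + 1 = 2 * (2 * n) + 1 by ring] at h
      simp only [H, E, LinearMap.funLeft_apply, Pi.add_apply, Pi.smul_apply, Pi.one_apply,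
        smul_eq_mul, h]
      ring
    · convert hD using 1
      ext n
      exact windowSpread_even n
    · exact hE
    · convert V.add_mem hD h1 using 1
      ext n
      have h := windowSpread_four_mul_add_one n
      rwa [show 4 * n + 1 = 2 * (2 * n) + 1 by ring] at h
    · exact h1
  · rintro t (rfl | rfl | rfl | rfl | rfl | rfl)
    · exact hH
    · convert V.add_mem (V.add_mem (V.smul_mem 2 hF) (V.smul_mem 2 h1)) hE using 1
      ext n
      have h := abComplexity_xw_four_mul_add_three n
      rw [windowSpread_four_mul_add_three, show 4 * n + 3 = 2 * (2 * n + 1) + 1 by ring] at h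
      simp only [H, F, E, LinearMap.funLeft_apply, Pi.add_apply, Pi.smul_apply, Pi.one_apply,
        smul_eq_mul, h]
      ring
    · exact hE
    · convert hF using 1
      ext n
      exact windowSpread_even (n + 1)
    · convert V.add_mem hF h1 using 1
      ext n
      have h := windowSpread_four_mul_add_three n
      rwa [show 4 * n + 3 = 2 * (2 * n + 1) + 1 by ring] at h
    · exact h1

theorem stmt4 :
    (∀ l, 2 ≤ l → ∀ r, r + 1 < 2 ^ l →
      (2 * r ≤ 2 ^ l → abComplexity xw (2 ^ l + r) = abComplexity xw r + 3) ∧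
      (2 ^ l < 2 * r → abComplexity xw (2 ^ l + r) = abComplexity xw (2 ^ (l + 1) - r))) ∧
    IsTwoRegular fun n => (abComplexity xw n : ℤ) := by
  refine ⟨fun l hl r hr => ⟨abComplexity_xw_two_pow_add hl, fun _ => ?_⟩,
    isTwoRegular_abComplexity_xw⟩
  have e : 2 ^ (l + 1) = 2 * 2 ^ l := by ring
  exact abComplexity_xw_reflect hl (by omega) (by omega) (by omega)
end

section
/- For n odd, P²_t(n+1) − P¹_y(n) equals: Δ₁₂(n) + 2 − 2·JM₀₃(n) − 2·jm₀₃(n) if m₁₂(n) and Δ₁₂(n) are both even; Δ₁₂(n) + 1 − 2·JM₀₃(n) if m₁₂(n) is even and Δ₁₂(n) is odd; Δ₁₂(n) + 1 − 2·jm₀₃(n) if m₁₂(n) and Δ₁₂(n) are both odd; Δ₁₂(n) if m₁₂(n) is odd and Δ₁₂(n) is even. For n even, P²_t(n+1) − P¹_y(n) equals: Δ₁₂(n)/2 + 1 if m₁₂(n) and Δ₁₂(n) are both even; Δ₁₂(n)/2 if m₁₂(n) is odd and Δ₁₂(n) is even; Δ₁₂(n)/2 + 1/2 if Δ₁₂(n)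 is odd. -/
open Finset in
/-- The number of occurrences of the letter `v` in the factor of `y` of length `n` at `i`. -/
def yCount (v i n : ℕ) : ℕ := ∑ j ∈ range n, if yw (i + j) = v then 1 else 0

section ThueMorse

theorem tm_two_mul (n : ℕ) : tm (2 * n) = tm n := by
  rcases Nat.eq_zero_or_pos n with rfl | h
  · rfl
  · simp [tm, Nat.digits_def' (b := 2) (n := 2 * n) (by norm_num) (by omega)]

theorem tm_le_one (n : ℕ) : tm n ≤ 1 := by
  have := Nat.mod_lt (Nat.digits 2 n).sum (y := 2) (by norm_num)
  unfold tm; omega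

theorem tm_two_mul_add_one (n : ℕ) : tm (2 * n + 1) = 1 - tm n := by
  unfold tm
  rw [Nat.digits_def' (b := 2) (n := 2 * n + 1) (by norm_num) (by omega)]
  have h1 : (2 * n + 1) % 2 = 1 := by omega
  have h2 : (2 * n + 1) / 2 = n := by omega
  rw [h1, h2, List.sum_cons]
  omega

theorem tm_add_two_pow (N : ℕ) : ∀ i < 2 ^ N, tm (i + 2 ^ N) = 1 - tm i := by
  induction N with
  | zero =>
    intro i hi
    obtain rfl : i = 0 := by simpa using hi
    simpa using tm_two_mul_add_one 0
  | succ N ih =>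
    intro i hi
    rw [pow_succ] at hi ⊢
    rcases Nat.even_or_odd' i with ⟨j, rfl | rfl⟩
    · rw [show 2 * j + 2 ^ N * 2 = 2 * (j + 2 ^ N) by ring, tm_two_mul, tm_two_mul,
        ih j (by omega)]
    · rw [show 2 * j + 1 + 2 ^ N * 2 = 2 * (j + 2 ^ N) + 1 by ring, tm_two_mul_add_one,
        tm_two_mul_add_one, ih j (by omega)]

/-- Factors of the Thue–Morse word are closed under complementation, preserving the parity of
the position. -/
theorem exists_complement (i n : ℕ) :
    ∃ i', i' % 2 = i % 2 ∧ ∀ k ≤ n, tm (i' + k) = 1 - tm (i + k) := by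
  refine ⟨i + 2 ^ (i + n + 1), ?_, fun k hk => ?_⟩
  · rw [pow_succ]; omega
  · have h : i + k < 2 ^ (i + n + 1) :=
      lt_of_lt_of_le (by omega) (Nat.lt_two_pow_self (n := i + n + 1)).le
    rw [← tm_add_two_pow _ _ h]
    congr 1; ring

end ThueMorse

section Counts

theorem yCount_succ (v i n : ℕ) :
    yCount v i (n + 1) = yCount v i n + if yw (i + n) = v then 1 else 0 :=
  Finset.sum_range_succ _ _

theorem yCount_succ' (v i n : ℕ) :
    yCount v i (n + 1) = yCount v (i + 1) n + if yw i = v then 1 else 0 := by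
  unfold yCount
  rw [Finset.sum_range_succ']
  simp [add_right_comm, ← add_assoc]

theorem factorAt_succ (w : ℕ → ℕ) (i n : ℕ) :
    factorAt w i (n + 1) = factorAt w i n ++ [w (i + n)] := by
  simp [factorAt, List.range_succ]

theorem count_factorAt_yw (v i n : ℕ) : (factorAt yw i n).count v = yCount v i n := by
  induction n with
  | zero => rfl
  | succ n ih => rw [factorAt_succ, List.count_append, ih, yCount_succ, List.count_singleton]; simp

theorem yw_cases (i : ℕ) :
    tm i = 0 ∧ tm (i + 1) = 0 ∧ yw i = 0 ∨ tm i = 0 ∧ tm (i + 1) = 1 ∧ yw i = 1 ∨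
    tm i = 1 ∧ tm (i + 1) = 0 ∧ yw i = 2 ∨ tm i = 1 ∧ tm (i + 1) = 1 ∧ yw i = 3 := by
  have h1 := tm_le_one i
  have h2 := tm_le_one (i + 1)
  unfold yw; omega

theorem sum_yCount (i n : ℕ) :
    yCount 0 i n + yCount 1 i n + yCount 2 i n + yCount 3 i n = n := by
  induction n with
  | zero => rfl
  | succ n ih =>
    simp only [yCount_succ]
    rcases yw_cases (i + n) with h | h | h | h <;> simp only [h] <;> simp <;> omega

/-- The numbers of rises and of descents differ by the difference of the boundary letters. -/
theorem yCount_one_add (i n : ℕ) : yCount 1 i n + tm i = yCount 2 i n + tm (i + n) := by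
  induction n with
  | zero => rfl
  | succ n ih =>
    simp only [yCount_succ]
    rw [← add_assoc i]
    rcases yw_cases (i + n) with h | h | h | h <;> simp only [h] at ih ⊢ <;> simp <;> omega

theorem yw_two_mul (j : ℕ) : yw (2 * j) = 1 ∨ yw (2 * j) = 2 := by
  have := tm_le_one j
  unfold yw; rw [tm_two_mul, tm_two_mul_add_one]; omega

theorem yw_two_mul_add_one (j : ℕ) : yw (2 * j + 1) = 2 * (1 - tm j) + tm (j + 1) := by
  unfold yw
  rw [tm_two_mul_add_one, show 2 * j + 1 + 1 = 2 * (j + 1) by ring, tm_two_mul]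

theorem yCount_even_even (j k : ℕ) : yCount 0 (2 * j) (2 * k) = yCount 2 j k ∧
    yCount 3 (2 * j) (2 * k) = yCount 1 j k := by
  induction k with
  | zero => exact ⟨rfl, rfl⟩
  | succ k ih =>
    rw [show 2 * (k + 1) = 2 * k + 1 + 1 by ring]
    simp only [yCount_succ]
    rw [← add_assoc, ← mul_add, yw_two_mul_add_one, ih.1, ih.2]
    have h' := yw_two_mul (j + k)
    rcases yw_cases (j + k) with h | h | h | h <;> rcases h' with h' | h' <;>
      simp [h, h']

theorem yCount_even_odd (j k : ℕ) : yCount 0 (2 * j) (2 * k + 1) = yCount 2 j k ∧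
    yCount 3 (2 * j) (2 * k + 1) = yCount 1 j k := by
  simp only [yCount_succ, yCount_even_even]
  rw [← mul_add]
  rcases yw_two_mul (j + k) with h' | h' <;> simp [h']

theorem yCount_odd_even (j k : ℕ) : yCount 0 (2 * j + 1) (2 * k) = yCount 2 j k ∧
    yCount 3 (2 * j + 1) (2 * k) = yCount 1 j k := by
  have h0 := yCount_succ' 0 (2 * j) (2 * k)
  have h3 := yCount_succ' 3 (2 * j) (2 * k)
  rw [(yCount_even_odd j k).1] at h0
  rw [(yCount_even_odd j k).2] at h3
  rcases yw_two_mul j with h' | h' <;> simp [h'] at h0 h3 <;> omega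

theorem yCount_odd_odd (j k : ℕ) : yCount 0 (2 * j + 1) (2 * k + 1) = yCount 2 j (k + 1) ∧
    yCount 3 (2 * j + 1) (2 * k + 1) = yCount 1 j (k + 1) := by
  have h0 := yCount_succ' 0 (2 * j) (2 * k + 1)
  have h3 := yCount_succ' 3 (2 * j) (2 * k + 1)
  have h := yCount_even_even j (k + 1)
  rw [show 2 * (k + 1) = 2 * k + 1 + 1 by ring] at h
  rw [h.1] at h0
  rw [h.2] at h3
  rcases yw_two_mul j with h' | h' <;> simp [h'] at h0 h3 <;> omega

theorem yCount_complement {i i' n : ℕ} (h : ∀ k ≤ n, tm (i' + k) = 1 - tm (i + k)) :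
    yCount 0 i' n = yCount 3 i n ∧ yCount 1 i' n = yCount 2 i n ∧
    yCount 2 i' n = yCount 1 i n ∧ yCount 3 i' n = yCount 0 i n := by
  induction n with
  | zero => exact ⟨rfl, rfl, rfl, rfl⟩
  | succ n ih =>
    obtain ⟨h0, h1, h2, h3⟩ := ih fun k hk => h k (by omega)
    simp only [yCount_succ, h0, h1, h2, h3]
    have e1 := h n (by omega)
    have e2 := h (n + 1) le_rfl
    rw [← add_assoc, ← add_assoc] at e2
    have e : yw (i' + n) = 2 * (1 - tm (i + n)) + (1 - tm (i + n + 1)) := by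
      rw [← e1, ← e2, yw]
    rw [e]
    rcases yw_cases (i + n) with h | h | h | h <;> simp [h]

end Counts

section Extrema

theorem isGreatest_M12 (n : ℕ) :
    IsGreatest (Set.range fun i => yCount 1 i n + yCount 2 i n) (M12 n) := by
  have e : {k | ∃ i, (factorAt yw i n).count 1 + (factorAt yw i n).count 2 = k} =
      Set.range fun i => yCount 1 i n + yCount 2 i n := by
    simp only [count_factorAt_yw]; rfl
  have hb : BddAbove (Set.range fun i => yCount 1 i n + yCount 2 i n) :=
    ⟨n, by rintro _ ⟨i, rfl⟩; have := sum_yCount i n; dsimp only; omega⟩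
  unfold M12
  rw [e]
  exact ⟨Nat.sSup_mem (Set.range_nonempty _) hb, fun _ hx => le_csSup hb hx⟩

theorem isLeast_m12 (n : ℕ) :
    IsLeast (Set.range fun i => yCount 1 i n + yCount 2 i n) (m12 n) := by
  have e : {k | ∃ i, (factorAt yw i n).count 1 + (factorAt yw i n).count 2 = k} =
      Set.range fun i => yCount 1 i n + yCount 2 i n := by
    simp only [count_factorAt_yw]; rfl
  unfold m12
  rw [e]
  exact ⟨Nat.sInf_mem (Set.range_nonempty _), fun _ hx => Nat.sInf_le hx⟩

theorem isGreatest_M03 (n : ℕ) :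
    IsGreatest (Set.range fun i => yCount 0 i n + yCount 3 i n) (M03 n) := by
  have e : {k | ∃ i, (factorAt yw i n).count 0 + (factorAt yw i n).count 3 = k} =
      Set.range fun i => yCount 0 i n + yCount 3 i n := by
    simp only [count_factorAt_yw]; rfl
  have hb : BddAbove (Set.range fun i => yCount 0 i n + yCount 3 i n) :=
    ⟨n, by rintro _ ⟨i, rfl⟩; have := sum_yCount i n; dsimp only; omega⟩
  unfold M03
  rw [e]
  exact ⟨Nat.sSup_mem (Set.range_nonempty _) hb, fun _ hx => le_csSup hb hx⟩

theorem isLeast_m03 (n : ℕ) :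
    IsLeast (Set.range fun i => yCount 0 i n + yCount 3 i n) (m03 n) := by
  have e : {k | ∃ i, (factorAt yw i n).count 0 + (factorAt yw i n).count 3 = k} =
      Set.range fun i => yCount 0 i n + yCount 3 i n := by
    simp only [count_factorAt_yw]; rfl
  unfold m03
  rw [e]
  exact ⟨Nat.sInf_mem (Set.range_nonempty _), fun _ hx => Nat.sInf_le hx⟩

theorem M12_succ (n : ℕ) : M12 n ≤ M12 (n + 1) ∧ M12 (n + 1) ≤ M12 n + 1 := by
  obtain ⟨⟨i, hi⟩, hu⟩ := isGreatest_M12 n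
  obtain ⟨⟨i', hi'⟩, hu'⟩ := isGreatest_M12 (n + 1)
  have h1 := hu ⟨i', rfl⟩
  have h2 := hu' ⟨i, rfl⟩
  simp only [yCount_succ] at *
  constructor
  · omega
  · rcases yw_cases (i' + n) with h | h | h | h <;> simp [h] at hi' <;> omega

theorem m12_succ (n : ℕ) : m12 n ≤ m12 (n + 1) ∧ m12 (n + 1) ≤ m12 n + 1 := by
  obtain ⟨⟨i, hi⟩, hu⟩ := isLeast_m12 n
  obtain ⟨⟨i', hi'⟩, hu'⟩ := isLeast_m12 (n + 1)
  have h1 := hu ⟨i', rfl⟩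
  have h2 := hu' ⟨i, rfl⟩
  simp only [yCount_succ] at *
  constructor
  · omega
  · rcases yw_cases (i + n) with h | h | h | h <;> simp [h] at h2 <;> omega

theorem m12_le_M12 (n : ℕ) : m12 n ≤ M12 n :=
  (isLeast_m12 n).2 (isGreatest_M12 n).1

theorem M12_le (n : ℕ) : M12 n ≤ n := by
  obtain ⟨⟨i, hi⟩, -⟩ := isGreatest_M12 n
  have := sum_yCount i n
  dsimp only at hi; omega

/-- For factors of even length, the numbers of non-changes are the numbers of changes in the
factors of half the length. -/
theorem range_yCount_even (k : ℕ) : (Set.range fun i => yCount 0 i (2 * k) + yCount 3 i (2 * k)) =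
    Set.range fun i => yCount 1 i k + yCount 2 i k := by
  ext x
  constructor
  · rintro ⟨i, rfl⟩
    rcases Nat.even_or_odd' i with ⟨j, rfl | rfl⟩
    · exact ⟨j, by simp only [yCount_even_even]; omega⟩
    · exact ⟨j, by simp only [yCount_odd_even]; omega⟩
  · rintro ⟨j, rfl⟩
    exact ⟨2 * j, by simp only [yCount_even_even]; omega⟩

theorem M03_two_mul (k : ℕ) : M03 (2 * k) = M12 k := by
  have h := isGreatest_M03 (2 * k)
  rw [range_yCount_even] at h
  exact h.unique (isGreatest_M12 k)

theorem m03_two_mul (k : ℕ) : m03 (2 * k) = m12 k := by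
  have h := isLeast_m03 (2 * k)
  rw [range_yCount_even] at h
  exact h.unique (isLeast_m12 k)

theorem range_yCount_odd (k : ℕ) :
    (Set.range fun i => yCount 0 i (2 * k + 1) + yCount 3 i (2 * k + 1)) =
      (Set.range fun i => yCount 1 i k + yCount 2 i k) ∪
        Set.range fun i => yCount 1 i (k + 1) + yCount 2 i (k + 1) := by
  ext x
  constructor
  · rintro ⟨i, rfl⟩
    rcases Nat.even_or_odd' i with ⟨j, rfl | rfl⟩
    · exact Or.inl ⟨j, by simp only [yCount_even_odd]; omega⟩
    · exact Or.inr ⟨j, by simp only [yCount_odd_odd]; omega⟩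
  · rintro (⟨j, rfl⟩ | ⟨j, rfl⟩)
    · exact ⟨2 * j, by simp only [yCount_even_odd]; omega⟩
    · exact ⟨2 * j + 1, by simp only [yCount_odd_odd]; omega⟩

theorem M03_two_mul_add_one (k : ℕ) : M03 (2 * k + 1) = M12 (k + 1) := by
  have h := isGreatest_M03 (2 * k + 1)
  rw [range_yCount_odd] at h
  rw [h.unique ((isGreatest_M12 k).union (isGreatest_M12 (k + 1)))]
  exact max_eq_right (M12_succ k).1

theorem m03_two_mul_add_one (k : ℕ) : m03 (2 * k + 1) = m12 k := by
  have h := isLeast_m03 (2 * k + 1)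
  rw [range_yCount_odd] at h
  rw [h.unique ((isLeast_m12 k).union (isLeast_m12 (k + 1)))]
  exact min_eq_left (m12_succ k).1

theorem M03_add_m12 (n : ℕ) : M03 n + m12 n = n := by
  obtain ⟨⟨i, hi⟩, hu⟩ := isGreatest_M03 n
  obtain ⟨⟨i', hi'⟩, hu'⟩ := isLeast_m12 n
  have h1 := hu ⟨i', rfl⟩
  have h2 := hu' ⟨i, rfl⟩
  have := sum_yCount i n
  have := sum_yCount i' n
  dsimp only at *; omega

theorem m03_add_M12 (n : ℕ) : m03 n + M12 n = n := by
  obtain ⟨⟨i, hi⟩, hu⟩ := isLeast_m03 n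
  obtain ⟨⟨i', hi'⟩, hu'⟩ := isGreatest_M12 n
  have h1 := hu ⟨i', rfl⟩
  have h2 := hu' ⟨i, rfl⟩
  have := sum_yCount i n
  have := sum_yCount i' n
  dsimp only at *; omega

/-- A function on `ℕ` with steps at most one takes all intermediate values. -/
theorem exists_eq_of_step_le_one {f : ℕ → ℕ} (h : ∀ i, f (i + 1) ≤ f i + 1 ∧ f i ≤ f (i + 1) + 1)
    {a b d : ℕ} (ha : f a ≤ d) (hb : d ≤ f b) : ∃ i, f i = d := by
  by_contra! hne
  have key : ∀ i, f i < d ↔ f (i + 1) < d := fun i => by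
    have := h i; have := hne i; have := hne (i + 1); omega
  have all : ∀ i, f i < d ↔ f 0 < d := fun i => by
    induction i with
    | zero => rfl
    | succ i ih => rw [← key, ih]
  have h1 := all a
  have h2 := all b
  have := hne a
  omega

theorem exists_yCount_eq_iff (n d : ℕ) :
    (∃ i, yCount 1 i n + yCount 2 i n = d) ↔ m12 n ≤ d ∧ d ≤ M12 n := by
  constructor
  · rintro ⟨i, rfl⟩
    exact ⟨(isLeast_m12 n).2 ⟨i, rfl⟩, (isGreatest_M12 n).2 ⟨i, rfl⟩⟩
  · rintro ⟨h1, h2⟩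
    obtain ⟨a, ha⟩ := (isLeast_m12 n).1
    obtain ⟨b, hb⟩ := (isGreatest_M12 n).1
    refine exists_eq_of_step_le_one (f := fun i => yCount 1 i n + yCount 2 i n) (fun i => ?_)
      (a := a) (b := b) (by rwa [← ha] at h1) (by rwa [← hb] at h2)
    have e1 := yCount_succ' 1 i n
    have e2 := yCount_succ' 2 i n
    rw [yCount_succ] at e1 e2
    rcases yw_cases i with h | h | h | h <;> rcases yw_cases (i + n) with h' | h' | h' | h' <;>
      simp [h, h'] at e1 e2 <;> omega

theorem ncard_even_between (a b : ℕ) :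
    {d | Even d ∧ a ≤ d ∧ d ≤ b}.ncard = b / 2 + 1 - (a + 1) / 2 := by
  have e : {d | Even d ∧ a ≤ d ∧ d ≤ b} =
      (fun x => 2 * x) '' (Finset.Ico ((a + 1) / 2) (b / 2 + 1) : Set ℕ) := by
    ext d
    simp only [Set.mem_ofPred_eq, Finset.coe_Ico, Set.mem_image, Set.mem_Ico]
    constructor
    · rintro ⟨⟨c, rfl⟩, h1, h2⟩
      exact ⟨c, by omega, by omega⟩
    · rintro ⟨c, h, rfl⟩
      exact ⟨⟨c, by omega⟩, by omega, by omega⟩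
  rw [e, Set.ncard_image_of_injective _ fun x y h => by simpa using h,
    Set.ncard_coe_finset, Nat.card_Ico]

end Extrema

section Complexity

/-- The Parikh vector of the factor of `y` of length `n` at `i`. -/
def parikh (n i : ℕ) : ℕ × ℕ × ℕ × ℕ :=
  (yCount 0 i n, yCount 1 i n, yCount 2 i n, yCount 3 i n)

theorem ncard_range_congr {α β γ : Type*} {f : α → β} {g : α → γ}
    (h : ∀ i j, f i = f j ↔ g i = g j) : (Set.range f).ncard = (Set.range g).ncard := by
  refine Set.ncard_congr (fun _ hx => g hx.choose) (fun _ hx => ⟨_, rfl⟩) ?_ ?_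
  · intro a b ha hb hab
    rw [← ha.choose_spec, ← hb.choose_spec]
    exact (h _ _).2 hab
  · rintro _ ⟨i, rfl⟩
    have hi : ∃ j, f j = f i := ⟨i, rfl⟩
    exact ⟨f i, hi, (h _ _).1 hi.choose_spec⟩

theorem finite_range_parikh (n : ℕ) : (Set.range (parikh n)).Finite := by
  refine (Set.finite_Icc (0 : ℕ × ℕ × ℕ × ℕ) (n, n, n, n)).subset ?_
  rintro _ ⟨i, rfl⟩
  have := sum_yCount i n
  exact ⟨bot_le, by simp only [parikh, Prod.mk_le_mk]; omega⟩

theorem yCount_eq_zero {v : ℕ} (hv : 4 ≤ v) (i n : ℕ) : yCount v i n = 0 := by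
  refine Finset.sum_eq_zero fun j _ => if_neg ?_
  rcases yw_cases (i + j) with h | h | h | h <;> omega

theorem abComplexity_yw (n : ℕ) : abComplexity yw n = (Set.range (parikh n)).ncard := by
  refine ncard_range_congr (f := fun i => (↑(factorAt yw i n) : Multiset ℕ)) fun i j => ?_
  simp only [Multiset.ext, Multiset.coe_count, count_factorAt_yw, parikh, Prod.mk.injEq]
  constructor
  · intro h
    exact ⟨h 0, h 1, h 2, h 3⟩
  · rintro ⟨h0, h1, h2, h3⟩ a
    match a with
    | 0 => exact h0
    | 1 => exact h1
    | 2 => exact h2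
    | 3 => exact h3
    | a + 4 => rw [yCount_eq_zero (by omega), yCount_eq_zero (by omega)]

theorem length_factorAt (w : ℕ → ℕ) (i n : ℕ) : (factorAt w i n).length = n := by
  simp [factorAt]

theorem take_drop_factorAt (w : ℕ → ℕ) (i : ℕ) {n j l : ℕ} (h : j + l ≤ n) :
    ((factorAt w i n).drop j).take l = factorAt w (i + j) l := by
  apply List.ext_getElem
  · simp [factorAt]; omega
  · intro k h1 h2
    simp [factorAt, add_assoc]

theorem countFactor_factorAt (w : ℕ → ℕ) (i n : ℕ) (v : List ℕ) :
    countFactor (factorAt w i n) v =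
      ∑ j ∈ Finset.range (n + 1 - v.length), if factorAt w (i + j) v.length = v then 1 else 0 := by
  unfold countFactor
  rw [length_factorAt, ← Finset.card_filter, ← List.toFinset_card_of_nodup
    (List.nodup_range.filter _)]
  congr 1
  ext j
  simp only [List.mem_toFinset, List.mem_filter, List.mem_range, decide_eq_true_eq,
    Finset.mem_filter, Finset.mem_range]
  refine and_congr_right fun hj => ?_
  rw [take_drop_factorAt w i (by omega)]

theorem countFactor_pair (i n a b : ℕ) (hb : b ≤ 1) :
    countFactor (factorAt tm i (n + 1)) [a, b] = yCount (2 * a + b) i n := by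
  rw [countFactor_factorAt]
  refine Finset.sum_congr rfl fun j _ => ?_
  refine if_congr ?_ rfl rfl
  have h1 := tm_le_one (i + j)
  have h2 := tm_le_one (i + j + 1)
  simp only [factorAt, List.length_cons, List.length_nil, List.range_succ, List.range_zero, yw]
  simp
  omega

theorem countFactor_pair_eq_zero (i n a b : ℕ) (h : 2 ≤ a ∨ 2 ≤ b) :
    countFactor (factorAt tm i (n + 1)) [a, b] = 0 := by
  rw [countFactor_factorAt]
  refine Finset.sum_eq_zero fun j _ => if_neg ?_
  have h1 := tm_le_one (i + j)
  have h2 := tm_le_one (i + j + 1)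
  simp only [factorAt, List.length_cons, List.length_nil, List.range_succ, List.range_zero]
  simp
  omega

theorem countFactor_singleton (i n a : ℕ) :
    countFactor (factorAt tm i (n + 1)) [a] =
      yCount (2 * a) i n + yCount (2 * a + 1) i n + if tm (i + n) = a then 1 else 0 := by
  rw [countFactor_factorAt]
  simp only [factorAt, List.length_cons, List.length_nil, List.range_succ, List.range_zero]
  simp only [yCount, ← Finset.sum_add_distrib]
  simp only [zero_add, List.nil_append, List.map_cons, List.map_nil, add_zero,
    List.cons.injEq, and_true, Nat.add_sub_cancel]
  rw [Finset.sum_range_succ]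
  congr 1
  refine Finset.sum_congr rfl fun j _ => ?_
  have h1 := tm_le_one (i + j)
  have h2 := tm_le_one (i + j + 1)
  unfold yw
  split_ifs <;> omega

theorem abel2Complexity_tm (n : ℕ) :
    abel2Complexity tm (n + 1) = (Set.range fun i => (parikh n i, tm i)).ncard := by
  unfold abel2Complexity
  have e : {f : List ℕ → ℕ | ∃ i, f = fun v => if v.length ≤ 2 then
        countFactor (factorAt tm i (n + 1)) v else 0} =
      Set.range fun i => fun v : List ℕ => if v.length ≤ 2 then
        countFactor (factorAt tm i (n + 1)) v else 0 := by
    ext f; simp only [Set.mem_ofPred_eq, Set.mem_range, eq_comm]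
  rw [e]
  refine ncard_range_congr fun i j => ?_
  have hi := yCount_one_add i n
  have hj := yCount_one_add j n
  have li := tm_le_one (i + n)
  have lj := tm_le_one (j + n)
  simp only [parikh, Prod.mk.injEq]
  constructor
  · intro h
    have h0 := congrFun h [0, 0]
    have h1 := congrFun h [0, 1]
    have h2 := congrFun h [1, 0]
    have h3 := congrFun h [1, 1]
    have h4 := congrFun h [0]
    simp [countFactor_pair, countFactor_singleton] at h0 h1 h2 h3 h4
    rw [h0, h1] at h4
    refine ⟨⟨h0, h1, h2, h3⟩, ?_⟩
    split_ifs at h4 <;> omega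
  · rintro ⟨⟨h0, h1, h2, h3⟩, h4⟩
    have h5 : tm (i + n) = tm (j + n) := by omega
    funext v
    match v with
    | [] => simp [countFactor_factorAt, length_factorAt, ← List.length_eq_zero_iff]
    | [0] => simp [countFactor_singleton, h0, h1, h5]
    | [1] => simp [countFactor_singleton, h2, h3, h5]
    | [a + 2] =>
      simp [countFactor_singleton, yCount_eq_zero (v := 2 * (a + 2)) (by omega),
        yCount_eq_zero (v := 2 * (a + 2) + 1) (by omega), h5]
    | [a, b] =>
      by_cases hab : 2 ≤ a ∨ 2 ≤ b
      · simp [countFactor_pair_eq_zero _ _ _ _ hab]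
      · have ha : a = 0 ∨ a = 1 := by omega
        have hb : b = 0 ∨ b = 1 := by omega
        rcases ha with rfl | rfl <;> rcases hb with rfl | rfl <;>
          simp [countFactor_pair, h0, h1, h2, h3]
    | _ :: _ :: _ :: _ => simp

/-- The Parikh vectors of factors of `y` of length `n` arising from factors of `t` starting with
`0` as well as from factors of `t` starting with `1`. -/
def sharedParikh (n : ℕ) : Set (ℕ × ℕ × ℕ × ℕ) :=
  (parikh n '' {i | tm i = 0}) ∩ (parikh n '' {i | tm i = 1})

theorem abel2Complexity_eq_add (n : ℕ) :
    abel2Complexity tm (n + 1) = abComplexity yw n + (sharedParikh n).ncard := by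
  have h01 : ∀ i, tm i = 0 ∨ tm i = 1 := fun i => by have := tm_le_one i; omega
  have hf : ∀ s, (parikh n '' s).Finite := fun s =>
    (finite_range_parikh n).subset (Set.image_subset_range _ _)
  have e1 : Set.range (parikh n) = (parikh n '' {i | tm i = 0}) ∪ (parikh n '' {i | tm i = 1}) := by
    rw [← Set.image_union, ← Set.image_univ]
    congr 1
    ext i; simpa using h01 i
  have e2 : (Set.range fun i => (parikh n i, tm i)) =
      ((fun c => (c, 0)) '' (parikh n '' {i | tm i = 0})) ∪
        ((fun c => (c, 1)) '' (parikh n '' {i | tm i = 1})) := by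
    ext x
    constructor
    · rintro ⟨i, rfl⟩
      rcases h01 i with h | h
      · exact Or.inl ⟨_, ⟨i, h, rfl⟩, by simp [h]⟩
      · exact Or.inr ⟨_, ⟨i, h, rfl⟩, by simp [h]⟩
    · rintro (⟨_, ⟨i, h, rfl⟩, rfl⟩ | ⟨_, ⟨i, h, rfl⟩, rfl⟩)
      · exact ⟨i, by simpa using h⟩
      · exact ⟨i, by simpa using h⟩
  rw [abel2Complexity_tm, abComplexity_yw, e1, sharedParikh, e2,
    Set.ncard_union_add_ncard_inter _ _ (hf _) (hf _), Set.ncard_union_eq ?_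
    ((hf _).image _) ((hf _).image _), Set.ncard_image_of_injective _ (Prod.mk_left_injective 0),
    Set.ncard_image_of_injective _ (Prod.mk_left_injective 1)]
  · rw [Set.disjoint_left]
    rintro _ ⟨c, -, rfl⟩ ⟨c', -, h⟩
    simp at h

theorem sharedParikh_even (k : ℕ) :
    sharedParikh (2 * k) = (fun d => ((2 * k - d) / 2, d / 2, d / 2, (2 * k - d) / 2)) ''
      {d | Even d ∧ m12 (2 * k) ≤ d ∧ d ≤ M12 (2 * k)} := by
  have key : ∀ i, Even (yCount 1 i (2 * k) + yCount 2 i (2 * k)) → parikh (2 * k) i =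
      (fun d => ((2 * k - d) / 2, d / 2, d / 2, (2 * k - d) / 2))
        (yCount 1 i (2 * k) + yCount 2 i (2 * k)) := by
    intro i hd
    obtain ⟨c, hc⟩ := hd
    have hs := sum_yCount i (2 * k)
    have hi := yCount_one_add i (2 * k)
    have l1 := tm_le_one i
    have l2 := tm_le_one (i + 2 * k)
    have h03 : yCount 0 i (2 * k) = yCount 3 i (2 * k) := by
      have h : yCount 0 i (2 * k) = yCount 2 (i / 2) k ∧
          yCount 3 i (2 * k) = yCount 1 (i / 2) k := by
        rcases Nat.even_or_odd' i with ⟨j, rfl | rfl⟩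
        · rw [show 2 * j / 2 = j by omega]; exact yCount_even_even j k
        · rw [show (2 * j + 1) / 2 = j by omega]; exact yCount_odd_even j k
      have h1 := yCount_one_add (i / 2) k
      have l3 := tm_le_one (i / 2)
      have l4 := tm_le_one (i / 2 + k)
      omega
    simp only [parikh, Prod.mk.injEq]
    omega
  ext x
  constructor
  · rintro ⟨⟨i, hi, rfl⟩, ⟨i', hi', h⟩⟩
    have hd : Even (yCount 1 i (2 * k) + yCount 2 i (2 * k)) := by
      have e := yCount_one_add i (2 * k)
      have e' := yCount_one_add i' (2 * k)
      have l1 := tm_le_one (i + 2 * k)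
      have l2 := tm_le_one (i' + 2 * k)
      simp only [parikh, Prod.mk.injEq, Set.mem_ofPred_eq] at h hi hi'
      exact ⟨yCount 1 i (2 * k), by omega⟩
    exact ⟨_, ⟨hd, (exists_yCount_eq_iff _ _).1 ⟨i, rfl⟩⟩, (key i hd).symm⟩
  · rintro ⟨d, ⟨hd, hm⟩, rfl⟩
    obtain ⟨i, rfl⟩ := (exists_yCount_eq_iff _ _).2 hm
    obtain ⟨i', -, hc⟩ := exists_complement i (2 * k)
    obtain ⟨-, h1, h2, -⟩ := yCount_complement hc
    have hs : yCount 1 i' (2 * k) + yCount 2 i' (2 * k) =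
        yCount 1 i (2 * k) + yCount 2 i (2 * k) := by omega
    have h0 := hc 0 (by omega)
    rw [add_zero, add_zero] at h0
    have l := tm_le_one i
    have k1 := key i hd
    have k2 := key i' (by rwa [hs])
    rw [hs] at k2
    rcases (by omega : tm i = 0 ∨ tm i = 1) with h | h
    · exact ⟨⟨i, h, k1⟩, ⟨i', by simp [h0, h], k2⟩⟩
    · exact ⟨⟨i', by simp [h0, h], k2⟩, ⟨i, h, k1⟩⟩

/-- The Parikh vector of a factor of odd length with an even number of changes is determined by
that number, the first letter of the corresponding factor of `t`, and the parity of the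
position. -/
theorem parikh_odd {i k d : ℕ} (hd : yCount 1 i (2 * k + 1) + yCount 2 i (2 * k + 1) = d)
    (he : Even d) : parikh (2 * k + 1) i =
      ((2 * k - d) / 2 + (i + tm i) % 2, d / 2, d / 2, (2 * k - d) / 2 + (i + tm i + 1) % 2) := by
  obtain ⟨c, hc⟩ := he
  have hs := sum_yCount i (2 * k + 1)
  have hi := yCount_one_add i (2 * k + 1)
  have l1 := tm_le_one i
  have l2 := tm_le_one (i + (2 * k + 1))
  simp only [parikh, Prod.mk.injEq]
  rcases Nat.even_or_odd' i with ⟨j, rfl | rfl⟩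
  · have h := yCount_even_odd j k
    have h1 := yCount_one_add j k
    have l3 := tm_le_one (j + k)
    have := tm_two_mul j
    omega
  · have h := yCount_odd_odd j k
    have h1 := yCount_one_add j (k + 1)
    have l3 := tm_le_one (j + (k + 1))
    have l4 := tm_le_one j
    have := tm_two_mul_add_one j
    omega

theorem sharedParikh_odd (k : ℕ) :
    sharedParikh (2 * k + 1) =
      (fun p : ℕ × ℕ => ((2 * k - p.1) / 2 + p.2, p.1 / 2, p.1 / 2, (2 * k - p.1) / 2 + (1 - p.2))) ''
      ({d | Even d ∧ 2 * k + 1 - M12 k ≤ d ∧ d ≤ 2 * k + 1 - m12 (k + 1)} ×ˢ {0, 1}) := by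
  have b1 := M12_le k
  have b2 := M12_le (k + 1)
  have b3 := m12_le_M12 (k + 1)
  have b4 := M12_succ k
  have b5 := m12_succ k
  have b6 := m12_le_M12 k
  ext x
  constructor
  · rintro ⟨⟨i, hi, rfl⟩, ⟨i', hi', h⟩⟩
    simp only [Set.mem_ofPred_eq] at hi hi'
    have e := yCount_one_add i (2 * k + 1)
    have e' := yCount_one_add i' (2 * k + 1)
    have s := sum_yCount i (2 * k + 1)
    have s' := sum_yCount i' (2 * k + 1)
    have l1 := tm_le_one (i + (2 * k + 1))
    have l2 := tm_le_one (i' + (2 * k + 1))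
    obtain ⟨h0, h1, h2, h3⟩ := by simpa only [parikh, Prod.mk.injEq] using h
    have hd : Even (yCount 1 i (2 * k + 1) + yCount 2 i (2 * k + 1)) :=
      ⟨yCount 1 i (2 * k + 1), by omega⟩
    have q := parikh_odd rfl hd
    have q' := parikh_odd (i := i') (k := k)
      (d := yCount 1 i (2 * k + 1) + yCount 2 i (2 * k + 1)) (by omega) hd
    have hpar : (i + tm i) % 2 = (i' + tm i') % 2 :=
      Nat.add_left_cancel (congrArg Prod.fst (q.symm.trans (h.symm.trans q')))
    have bounds : ∀ a b, a % 2 = 0 → b % 2 = 1 →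
        yCount 0 a (2 * k + 1) + yCount 3 a (2 * k + 1) =
          yCount 0 i (2 * k + 1) + yCount 3 i (2 * k + 1) →
        yCount 0 b (2 * k + 1) + yCount 3 b (2 * k + 1) =
          yCount 0 i (2 * k + 1) + yCount 3 i (2 * k + 1) →
        m12 (k + 1) ≤ yCount 0 i (2 * k + 1) + yCount 3 i (2 * k + 1) ∧
        yCount 0 i (2 * k + 1) + yCount 3 i (2 * k + 1) ≤ M12 k := by
      intro a b ha hb ea eb
      obtain ⟨p, rfl⟩ : ∃ p, a = 2 * p := ⟨a / 2, by omega⟩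
      obtain ⟨r, rfl⟩ : ∃ r, b = 2 * r + 1 := ⟨b / 2, by omega⟩
      have f1 := (exists_yCount_eq_iff k _).1 ⟨p, rfl⟩
      have f2 := (exists_yCount_eq_iff (k + 1) _).1 ⟨r, rfl⟩
      have g1 := yCount_even_odd p k
      have g2 := yCount_odd_odd r k
      omega
    have hb : m12 (k + 1) ≤ yCount 0 i (2 * k + 1) + yCount 3 i (2 * k + 1) ∧
        yCount 0 i (2 * k + 1) + yCount 3 i (2 * k + 1) ≤ M12 k := by
      rcases Nat.mod_two_eq_zero_or_one i with hp | hp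
      · exact bounds i i' hp (by omega) rfl (by omega)
      · exact bounds i' i (by omega) hp (by omega) rfl
    refine ⟨(yCount 1 i (2 * k + 1) + yCount 2 i (2 * k + 1), (i + tm i) % 2),
      ⟨⟨hd, by dsimp only; omega, by dsimp only; omega⟩, ?_⟩, ?_⟩
    · exact Nat.mod_two_eq_zero_or_one _
    · rw [q, show (i + tm i + 1) % 2 = 1 - (i + tm i) % 2 by omega]
  · rintro ⟨⟨d, s⟩, ⟨⟨hd, hd1, hd2⟩, hs⟩, rfl⟩
    dsimp only at hd hd1 hd2 hs ⊢
    replace hs : s = 0 ∨ s = 1 := hs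
    obtain ⟨p, hp⟩ := (exists_yCount_eq_iff k (2 * k + 1 - d)).2 (by omega)
    obtain ⟨r, hr⟩ := (exists_yCount_eq_iff (k + 1) (2 * k + 1 - d)).2 (by omega)
    have ep : yCount 1 (2 * p) (2 * k + 1) + yCount 2 (2 * p) (2 * k + 1) = d := by
      have := yCount_even_odd p k
      have := sum_yCount (2 * p) (2 * k + 1)
      omega
    have er : yCount 1 (2 * r + 1) (2 * k + 1) + yCount 2 (2 * r + 1) (2 * k + 1) = d := by
      have := yCount_odd_odd r k
      have := sum_yCount (2 * r + 1) (2 * k + 1)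
      omega
    have adjust : ∀ i, yCount 1 i (2 * k + 1) + yCount 2 i (2 * k + 1) = d → ∀ c ≤ 1,
        ∃ i', i' % 2 = i % 2 ∧ yCount 1 i' (2 * k + 1) + yCount 2 i' (2 * k + 1) = d ∧
          tm i' = c := by
      intro i hi c hc
      have l := tm_le_one i
      by_cases h : tm i = c
      · exact ⟨i, rfl, hi, h⟩
      · obtain ⟨i', h1, h2⟩ := exists_complement i (2 * k + 1)
        have h3 := yCount_complement h2
        have h4 := h2 0 (by omega)
        rw [add_zero, add_zero] at h4
        exact ⟨i', h1, by omega, by omega⟩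
    have main : ∀ c ≤ 1, ∃ i, tm i = c ∧ parikh (2 * k + 1) i =
        ((2 * k - d) / 2 + s, d / 2, d / 2, (2 * k - d) / 2 + (1 - s)) := by
      intro c hc
      have : ∃ i, (i + c) % 2 = s ∧ yCount 1 i (2 * k + 1) + yCount 2 i (2 * k + 1) = d ∧
          tm i = c := by
        by_cases hcs : c = s
        · obtain ⟨i, h1, h2, h3⟩ := adjust _ ep c hc
          exact ⟨i, by omega, h2, h3⟩
        · obtain ⟨i, h1, h2, h3⟩ := adjust _ er c hc
          exact ⟨i, by omega, h2, h3⟩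
      obtain ⟨i, h1, h2, h3⟩ := this
      refine ⟨i, h3, ?_⟩
      rw [parikh_odd h2 hd, h3, h1, show (i + c + 1) % 2 = 1 - s by omega]
    exact ⟨main 0 (by omega), main 1 le_rfl⟩

theorem ncard_sharedParikh_even (k : ℕ) :
    (sharedParikh (2 * k)).ncard = M12 (2 * k) / 2 + 1 - (m12 (2 * k) + 1) / 2 := by
  rw [sharedParikh_even, Set.InjOn.ncard_image, ncard_even_between]
  rintro d ⟨⟨c, rfl⟩, -⟩ d' ⟨⟨c', rfl⟩, -⟩ h
  simp only [Prod.mk.injEq] at h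
  omega

theorem ncard_sharedParikh_odd (k : ℕ) :
    (sharedParikh (2 * k + 1)).ncard =
      ((2 * k + 1 - m12 (k + 1)) / 2 + 1 - (2 * k + 1 - M12 k + 1) / 2) * 2 := by
  rw [sharedParikh_odd, Set.InjOn.ncard_image, Set.ncard_prod, ncard_even_between,
    Set.ncard_pair zero_ne_one]
  rintro ⟨d, s⟩ ⟨⟨⟨c, hc⟩, -⟩, hs⟩ ⟨d', s'⟩ ⟨⟨⟨c', hc'⟩, -⟩, hs'⟩ h
  simp only [Prod.mk.injEq] at h hc hc' ⊢
  obtain rfl : d = d' := by omega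
  omega

end Complexity

theorem stmt18 (n : ℕ) :
    (Odd n →
      (Even (m12 n) → Even (D12 n) →
        (abel2Complexity tm (n + 1) : ℤ) - (abComplexity yw n : ℤ) =
          (D12 n : ℤ) + 2 - 2 * (JM03 n : ℤ) - 2 * (jm03 n : ℤ)) ∧
      (Even (m12 n) → Odd (D12 n) →
        (abel2Complexity tm (n + 1) : ℤ) - (abComplexity yw n : ℤ) =
          (D12 n : ℤ) + 1 - 2 * (JM03 n : ℤ)) ∧
      (Odd (m12 n) → Odd (D12 n) →
        (abel2Complexity tm (n + 1) : ℤ) - (abComplexity yw n : ℤ) =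
          (D12 n : ℤ) + 1 - 2 * (jm03 n : ℤ)) ∧
      (Odd (m12 n) → Even (D12 n) →
        (abel2Complexity tm (n + 1) : ℤ) - (abComplexity yw n : ℤ) = (D12 n : ℤ))) ∧
    (Even n →
      (Even (m12 n) → Even (D12 n) →
        2 * ((abel2Complexity tm (n + 1) : ℤ) - (abComplexity yw n : ℤ)) = (D12 n : ℤ) + 2) ∧
      (Odd (m12 n) → Even (D12 n) →
        2 * ((abel2Complexity tm (n + 1) : ℤ) - (abComplexity yw n : ℤ)) = (D12 n : ℤ)) ∧
      (Odd (D12 n) →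
        2 * ((abel2Complexity tm (n + 1) : ℤ) - (abComplexity yw n : ℤ)) = (D12 n : ℤ) + 1)) := by
  have hP := abel2Complexity_eq_add n
  have hM := m12_le_M12 n
  constructor
  · rintro ⟨k, rfl⟩
    have hn := ncard_sharedParikh_odd k
    have e1 := M03_add_m12 (2 * k + 1)
    have e2 := m03_add_M12 (2 * k + 1)
    have b1 := M12_le k
    have b2 := M12_le (k + 1)
    have b3 := m12_le_M12 (k + 1)
    have b4 := M12_succ k
    have b5 := m12_succ k
    have b6 := m12_le_M12 k
    have f1 := M03_two_mul_add_one k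
    have f2 := m03_two_mul_add_one k
    have j1 : JM03 (2 * k + 1) + M12 k = M12 (k + 1) := by
      unfold JM03
      rw [Nat.add_sub_cancel, M03_two_mul, M03_two_mul_add_one]
      split_ifs <;> omega
    have j2 : jm03 (2 * k + 1) + m12 k = m12 (k + 1) := by
      unfold jm03
      rw [show 2 * k + 1 + 1 = 2 * (k + 1) by ring, m03_two_mul, m03_two_mul_add_one]
      split_ifs <;> omega
    simp only [Nat.even_iff, Nat.odd_iff, D12]
    refine ⟨?_, ?_, ?_, ?_⟩ <;> intro h1 h2 <;> omega
  · rintro ⟨k, rfl⟩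
    rw [← two_mul] at *
    have hn := ncard_sharedParikh_even k
    simp only [Nat.even_iff, Nat.odd_iff, D12]
    refine ⟨?_, ?_, ?_⟩
    · intro h1 h2; omega
    · intro h1 h2; omega
    · intro h1; omega
end
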